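/- Let n ≥ 2, α ∈ ℝ, 0 < p < ∞, and q⃗ = (q_1,…,q_n) with 1 < q_i < ∞ for each i. If −Σ_{i=1}^n 1/q_i < α < Σ_{i=1}^n 1/q_i' (where 1/q_i + 1/q_i' = 1), then the Hardy–Littlewood maximal operator M is bounded on the mixed Herz space K̇^{α,p}_{q⃗}(ℝⁿ): there is C > 0 such that every f with ‖f‖_{K̇^{α,p}_{q⃗}} < ∞ is locally integrable and ‖Mf‖_{K̇^{α,p}_{q⃗}} ≤ C‖f‖_{K̇^{α,p}_{q⃗}}. -/

import Mathlib

open MeasureTheory ENNReal Set Filter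
open scoped NNReal Topology

noncomputable section

/-- Euclidean space `ℝⁿ`. -/
abbrev Euc (n : ℕ) := EuclideanSpace ℝ (Fin n)

/-- The dyadic annulus `C_k = B(0,2^k) \ B(0,2^{k-1})`. -/
def annulus (n : ℕ) (k : ℤ) : Set (Euc n) :=
  Metric.ball (0 : Euc n) ((2 : ℝ) ^ k) \ Metric.ball (0 : Euc n) ((2 : ℝ) ^ (k - 1))

/-- The Hardy–Littlewood maximal operator, acting on nonnegative extended-real-valued
functions (representing `|f|`): `Mf(x) = sup_{B ∋ x} |B|⁻¹ ∫_B f`. -/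
def maximalFn {n : ℕ} (f : Euc n → ℝ≥0∞) (x : Euc n) : ℝ≥0∞ :=
  ⨆ (c : Euc n) (r : ℝ) (_ : 0 < r) (_ : x ∈ Metric.ball c r),
    (volume (Metric.ball c r))⁻¹ * ∫⁻ y in Metric.ball c r, f y ∂volume

/-- A ball Banach function space on `ℝⁿ`, encoded by its norm functional `N`,
defined on all nonnegative extended-real-valued measurable functions (a real measurable
function `f` has norm `N (fun x => ‖f x‖₊)`). -/
structure BallBFS (n : ℕ) where
  N : (Euc n → ℝ≥0∞) → ℝ≥0∞
  norm_zero_iff : ∀ f : Euc n → ℝ≥0∞, Measurable f → (N f = 0 ↔ f =ᵐ[volume] 0)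
  norm_mono : ∀ f g : Euc n → ℝ≥0∞, (∀ᵐ x ∂volume, g x ≤ f x) → N g ≤ N f
  norm_isup : ∀ f : ℕ → Euc n → ℝ≥0∞, (∀ m, ∀ᵐ x ∂volume, f m x ≤ f (m + 1) x) →
    N (fun x => ⨆ m, f m x) = ⨆ m, N (f m)
  ball_mem : ∀ (x : Euc n) (r : ℝ), 0 < r → N ((Metric.ball x r).indicator 1) < ∞
  norm_add : ∀ f g : Euc n → ℝ≥0∞, N (fun x => f x + g x) ≤ N f + N g
  ball_integral : ∀ (x : Euc n) (r : ℝ), 0 < r → ∃ C : ℝ≥0∞, 0 < C ∧ C < ∞ ∧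
    ∀ f : Euc n → ℝ≥0∞, N f < ∞ → ∫⁻ y in Metric.ball x r, f y ∂volume ≤ C * N f

/-- The associate ("Köthe dual") norm of a norm functional `N`:
`‖g‖_{X'} = sup { ∫ f·g : ‖f‖_X ≤ 1 }`. -/
def assocN {n : ℕ} (N : (Euc n → ℝ≥0∞) → ℝ≥0∞) (g : Euc n → ℝ≥0∞) : ℝ≥0∞ :=
  ⨆ (f : Euc n → ℝ≥0∞) (_ : Measurable f) (_ : N f ≤ 1), ∫⁻ x, f x * g x ∂volume

/-- The homogeneous Herz-type quasinorm associated with a norm functional `N`,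
for a finite exponent `0 < p < ∞`:
`‖f‖ = (Σ_{k∈ℤ} 2^{kpα} ‖f χ_k‖_X ^ p)^{1/p}`. -/
def herzNorm {n : ℕ} (N : (Euc n → ℝ≥0∞) → ℝ≥0∞) (α p : ℝ) (f : Euc n → ℝ≥0∞) : ℝ≥0∞ :=
  (∑' k : ℤ, (2 : ℝ≥0∞) ^ ((k : ℝ) * p * α) * (N ((annulus n k).indicator f)) ^ p) ^ (1 / p)

/-- The homogeneous Herz-type quasinorm, with exponent `p ∈ (0,∞]`
(for `p = ∞` the sum is replaced by a supremum). -/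
def herzNormE {n : ℕ} (N : (Euc n → ℝ≥0∞) → ℝ≥0∞) (α : ℝ) (p : ℝ≥0∞)
    (f : Euc n → ℝ≥0∞) : ℝ≥0∞ :=
  if p = ∞ then ⨆ k : ℤ, (2 : ℝ≥0∞) ^ ((k : ℝ) * α) * N ((annulus n k).indicator f)
  else herzNorm N α p.toReal f

/-- The iterated mixed-norm functional on `Fin m → ℝ`: one takes the `L^{q 0}` norm in the
first variable, then the `L^{q 1}` norm in the second variable, and so on. -/
def mixedNormAux : (m : ℕ) → (Fin m → ℝ) → ((Fin m → ℝ) → ℝ≥0∞) → ℝ≥0∞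
  | 0, _, f => f ![]
  | m + 1, q, f => mixedNormAux m (fun i => q i.succ)
      (fun x => (∫⁻ t : ℝ, f (Fin.cons t x) ^ q 0 ∂volume) ^ (1 / q 0))

/-- The mixed-norm Lebesgue quasinorm `‖f‖_{L^{q⃗}}` on `ℝⁿ`, applied to nonnegative
extended-real-valued `f` (representing `|f|`). -/
def mixedNorm {n : ℕ} (q : Fin n → ℝ) (f : Euc n → ℝ≥0∞) : ℝ≥0∞ :=
  mixedNormAux n q (fun x => f ((EuclideanSpace.equiv (Fin n) ℝ).symm x))

/-- The Herz quasinorm of a real-valued function (finite exponent `p`). -/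
def herzR {n : ℕ} (N : (Euc n → ℝ≥0∞) → ℝ≥0∞) (α p : ℝ) (f : Euc n → ℝ) : ℝ≥0∞ :=
  herzNorm N α p (fun x => (‖f x‖₊ : ℝ≥0∞))

/-! ### Geometric sums -/

lemma two_rpow_ne_zero (x : ℝ) : (2 : ℝ≥0∞) ^ x ≠ 0 := by
  simp [ENNReal.rpow_eq_zero_iff]

lemma two_rpow_ne_top (x : ℝ) : (2 : ℝ≥0∞) ^ x ≠ ∞ := by
  simp [ENNReal.rpow_eq_top_iff]

lemma two_rpow_add (x y : ℝ) : (2 : ℝ≥0∞) ^ (x + y) = 2 ^ x * 2 ^ y :=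
  ENNReal.rpow_add _ _ (by simp) (by simp)

lemma two_rpow_le {x y : ℝ} (h : x ≤ y) : (2 : ℝ≥0∞) ^ x ≤ 2 ^ y :=
  ENNReal.rpow_le_rpow_of_exponent_le (by norm_num) h

lemma tsum_nat_two_rpow_ne_top {d : ℝ} (hd : 0 < d) :
    ∑' m : ℕ, (2 : ℝ≥0∞) ^ (-(d * m)) ≠ ∞ := by
  have h : ∀ m : ℕ, (2 : ℝ≥0∞) ^ (-(d * m)) = ((2 : ℝ≥0∞) ^ (-d)) ^ m := by
    intro m
    rw [← ENNReal.rpow_natCast, ← ENNReal.rpow_mul]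
    ring_nf
  simp_rw [h, ENNReal.tsum_geometric]
  have : (2 : ℝ≥0∞) ^ (-d) < 1 :=
    ENNReal.rpow_lt_one_of_one_lt_of_neg (by norm_num) (by linarith)
  simpa [ENNReal.inv_eq_top, tsub_eq_zero_iff_le] using this

lemma tsum_int_two_rpow_ne_top {d : ℝ} (hd : 0 < d) :
    ∑' m : ℤ, (2 : ℝ≥0∞) ^ (-(d * |(m : ℝ)|)) ≠ ∞ := by
  have h := HasSum.of_nat_of_neg_add_one (f := fun m : ℤ => (2 : ℝ≥0∞) ^ (-(d * |(m : ℝ)|)))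
    ENNReal.summable.hasSum ENNReal.summable.hasSum
  rw [h.tsum_eq]
  refine ENNReal.add_ne_top.2 ⟨?_, ?_⟩
  · simpa using tsum_nat_two_rpow_ne_top hd
  · refine ne_top_of_le_ne_top (tsum_nat_two_rpow_ne_top hd) (ENNReal.tsum_le_tsum fun m => ?_)
    refine two_rpow_le ?_
    have : |((-((m : ℤ) + 1) : ℤ) : ℝ)| = m + 1 := by
      push_cast
      rw [abs_of_nonpos (by linarith [(Nat.cast_nonneg m : (0 : ℝ) ≤ m)])]
      ring
    rw [this]
    nlinarith

lemma tsum_mul_rpow_le {ι : Type*} {p : ℝ} (hp : 0 < p) (a b : ι → ℝ≥0∞) :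
    (∑' i, a i * b i) ^ p ≤ (∑' i, a i) ^ p * ∑' i, b i ^ p := by
  have h1 : ∑' i, a i * b i ≤ (∑' i, a i) * ⨆ i, b i := by
    rw [← ENNReal.tsum_mul_right]
    exact ENNReal.tsum_le_tsum fun i => mul_le_mul_right (le_iSup b i) _
  have h2 : (⨆ i, b i) ^ p ≤ ∑' i, b i ^ p := by
    have : (⨆ i, b i) ≤ (∑' i, b i ^ p) ^ p⁻¹ := by
      refine iSup_le fun i => ?_
      rw [ENNReal.le_rpow_inv_iff hp]
      exact ENNReal.le_tsum i
    rwa [ENNReal.le_rpow_inv_iff hp] at this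
  calc _ ≤ ((∑' i, a i) * ⨆ i, b i) ^ p := ENNReal.rpow_le_rpow h1 hp.le
    _ = (∑' i, a i) ^ p * (⨆ i, b i) ^ p := ENNReal.mul_rpow_of_nonneg _ _ hp.le
    _ ≤ _ := mul_le_mul_right h2 _

lemma exists_two_rpow_lt_le {a : ℝ≥0∞} (h0 : a ≠ 0) (ht : a ≠ ∞) :
    ∃ j : ℤ, (2 : ℝ≥0∞) ^ (j : ℝ) < a ∧ a ≤ 2 ^ ((j : ℝ) + 1) := by
  obtain ⟨j, h1, h2⟩ := ENNReal.exists_mem_Ioc_zpow h0 ht (y := 2) (by norm_num) (by simp)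
  refine ⟨j, by rwa [ENNReal.rpow_intCast], ?_⟩
  rw [← ENNReal.rpow_intCast] at h2
  exact_mod_cast h2

/-- Discrete layer-cake bound. -/
lemma rpow_le_tsum_layers {p : ℝ} (hp : 0 < p) (a : ℝ≥0∞) :
    a ^ p ≤ ∑' k : ℤ, if (2 : ℝ≥0∞) ^ (k : ℝ) < a then (2 : ℝ≥0∞) ^ (((k : ℝ) + 1) * p) else 0 := by
  rcases eq_or_ne a 0 with rfl | h0
  · simp [hp]
  rcases eq_or_ne a ∞ with rfl | ht
  · refine le_of_le_of_eq le_top (Eq.symm ?_)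
    refine top_unique ?_
    have : ∀ k : ℕ, (1 : ℝ≥0∞) ≤ if (2 : ℝ≥0∞) ^ (((k : ℤ)) : ℝ) < ∞ then
        (2 : ℝ≥0∞) ^ ((((k : ℤ) : ℝ) + 1) * p) else 0 := by
      intro k
      rw [if_pos (lt_top_iff_ne_top.2 (two_rpow_ne_top _))]
      calc (1 : ℝ≥0∞) = 2 ^ (0 : ℝ) := by simp
        _ ≤ _ := two_rpow_le (by push_cast; positivity)
    calc (∞ : ℝ≥0∞) = ∑' _ : ℕ, (1 : ℝ≥0∞) := by
          rw [ENNReal.tsum_const_eq_top_of_ne_zero one_ne_zero]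
      _ ≤ _ := ENNReal.tsum_le_tsum this
      _ ≤ _ := ENNReal.tsum_comp_le_tsum_of_injective Nat.cast_injective
        (fun k : ℤ => if (2 : ℝ≥0∞) ^ (k : ℝ) < ∞ then (2 : ℝ≥0∞) ^ (((k : ℝ) + 1) * p) else 0)
  obtain ⟨j, h1, h2⟩ := exists_two_rpow_lt_le h0 ht
  calc a ^ p ≤ (2 ^ ((j : ℝ) + 1)) ^ p := ENNReal.rpow_le_rpow h2 hp.le
    _ = if (2 : ℝ≥0∞) ^ (j : ℝ) < a then (2 : ℝ≥0∞) ^ (((j : ℝ) + 1) * p) else 0 := by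
      rw [if_pos h1, ENNReal.rpow_mul]
    _ ≤ _ := ENNReal.le_tsum j

lemma tsum_layers_le {d : ℝ} (hd : 0 < d) {a : ℝ≥0∞} (ha : a ≠ ∞) :
    ∑' k : ℤ, (if (2 : ℝ≥0∞) ^ (k : ℝ) < 2 * a then (2 : ℝ≥0∞) ^ ((k : ℝ) * d) else 0) ≤
      2 ^ (2 * d) * (∑' m : ℤ, (2 : ℝ≥0∞) ^ (-(d * |(m : ℝ)|))) * a ^ d := by
  rcases eq_or_ne a 0 with rfl | h0
  · simp
  obtain ⟨j, h1, h2⟩ := exists_two_rpow_lt_le h0 ha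
  have key : ∀ k : ℤ, (if (2 : ℝ≥0∞) ^ (k : ℝ) < 2 * a then (2 : ℝ≥0∞) ^ ((k : ℝ) * d) else 0) ≤
      2 ^ (2 * d) * a ^ d * (2 : ℝ≥0∞) ^ (-(d * |((k - (j + 2) : ℤ) : ℝ)|)) := by
    intro k
    split_ifs with hk
    · have hkj : (k : ℝ) < (j : ℝ) + 2 := by
        by_contra hcon
        push Not at hcon
        have : (2 : ℝ≥0∞) * a ≤ 2 ^ (k : ℝ) := by
          calc (2 : ℝ≥0∞) * a ≤ 2 * 2 ^ ((j : ℝ) + 1) := mul_le_mul_right h2 _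
            _ = 2 ^ (1 + ((j : ℝ) + 1)) := by rw [two_rpow_add 1]; simp
            _ ≤ _ := two_rpow_le (by linarith)
        exact absurd hk (not_lt.2 this)
      have e : |((k - (j + 2) : ℤ) : ℝ)| = (j : ℝ) + 2 - k := by
        push_cast
        rw [abs_of_nonpos (by linarith)]
        ring
      rw [e]
      calc (2 : ℝ≥0∞) ^ ((k : ℝ) * d)
          = 2 ^ (2 * d) * (2 ^ (j : ℝ)) ^ d * 2 ^ (-(d * ((j : ℝ) + 2 - k))) := by
            rw [← ENNReal.rpow_mul, ← two_rpow_add, ← two_rpow_add]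
            congr 1
            ring
        _ ≤ _ := by
            gcongr
    · exact zero_le
  calc _ ≤ ∑' k : ℤ, 2 ^ (2 * d) * a ^ d * (2 : ℝ≥0∞) ^ (-(d * |((k - (j + 2) : ℤ) : ℝ)|)) :=
        ENNReal.tsum_le_tsum key
    _ = 2 ^ (2 * d) * a ^ d * ∑' k : ℤ, (2 : ℝ≥0∞) ^ (-(d * |((k - (j + 2) : ℤ) : ℝ)|)) :=
        ENNReal.tsum_mul_left
    _ = 2 ^ (2 * d) * a ^ d * ∑' k : ℤ, (2 : ℝ≥0∞) ^ (-(d * |(k : ℝ)|)) := by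
        congr 1
        exact (Equiv.subRight (j + 2)).tsum_eq
          (fun k : ℤ => (2 : ℝ≥0∞) ^ (-(d * |(k : ℝ)|)))
    _ = _ := by ring

/-! ### The uncentred maximal operator on the line for an arbitrary measure -/

/-- The open interval with the given rational endpoints. -/
def ratIoo (r : ℚ × ℚ) : Set ℝ := Ioo (r.1 : ℝ) r.2

/-- The uncentred maximal operator over intervals with rational endpoints. -/
def lineMax (μ : Measure ℝ) (f : ℝ → ℝ≥0∞) (s : ℝ) : ℝ≥0∞ :=
  ⨆ r : ℚ × ℚ, (ratIoo r).indicator (fun _ => (μ (ratIoo r))⁻¹ * ∫⁻ y in ratIoo r, f y ∂μ) s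

lemma measurableSet_ratIoo (r : ℚ × ℚ) : MeasurableSet (ratIoo r) := measurableSet_Ioo

lemma average_le_lineMax (μ : Measure ℝ) (f : ℝ → ℝ≥0∞) {r : ℚ × ℚ} {s : ℝ} (hs : s ∈ ratIoo r) :
    (μ (ratIoo r))⁻¹ * ∫⁻ y in ratIoo r, f y ∂μ ≤ lineMax μ f s := by
  refine le_trans ?_ (le_iSup _ r)
  simp [hs]

lemma lineMax_le {μ : Measure ℝ} {f : ℝ → ℝ≥0∞} {s : ℝ} {A : ℝ≥0∞}
    (h : ∀ r, s ∈ ratIoo r → (μ (ratIoo r))⁻¹ * ∫⁻ y in ratIoo r, f y ∂μ ≤ A) :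
    lineMax μ f s ≤ A := by
  refine iSup_le fun r => ?_
  by_cases hs : s ∈ ratIoo r
  · simpa [hs] using h r hs
  · simp [hs]

lemma measurable_lineMax (μ : Measure ℝ) (f : ℝ → ℝ≥0∞) : Measurable (lineMax μ f) :=
  Measurable.iSup fun r => measurable_const.indicator (measurableSet_ratIoo r)

lemma lineMax_mono (μ : Measure ℝ) {f g : ℝ → ℝ≥0∞} (h : ∀ s, f s ≤ g s) (s : ℝ) :
    lineMax μ f s ≤ lineMax μ g s :=
  lineMax_le fun _ hs => le_trans (mul_le_mul_right (lintegral_mono h) _)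
    (average_le_lineMax μ g hs)

/-- A finite family of intervals has a subfamily with the same union and overlap at most two. -/
lemma exists_subfamily_overlap_le_two (S : Finset (ℚ × ℚ)) :
    ∃ T ⊆ S, (⋃ r ∈ S, ratIoo r) = (⋃ r ∈ T, ratIoo r) ∧
      ∀ y, ∑ r ∈ T, (ratIoo r).indicator (1 : ℝ → ℝ≥0∞) y ≤ 2 := by
  classical
  induction S using Finset.strongInduction with
  | H S ih =>
  by_cases hS : ∃ r ∈ S, ratIoo r ⊆ ⋃ r' ∈ S.erase r, ratIoo r'
  · obtain ⟨r, hr, hsub⟩ := hS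
    obtain ⟨T, hT, hU, hov⟩ := ih (S.erase r) (Finset.erase_ssubset hr)
    refine ⟨T, hT.trans (Finset.erase_subset _ _), ?_, hov⟩
    rw [← hU]
    refine Subset.antisymm (iUnion₂_subset fun r' hr' => ?_)
      (biUnion_subset_biUnion_left (Finset.erase_subset _ _))
    by_cases h : r' = r
    · rwa [h]
    · exact subset_biUnion_of_mem (u := ratIoo) (s := (S.erase r : Set (ℚ × ℚ)))
        (by simpa [h] using hr')
  · push Not at hS
    refine ⟨S, subset_rfl, rfl, fun y => ?_⟩
    by_contra hcon
    push Not at hcon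
    set F := S.filter (fun r => y ∈ ratIoo r) with hF
    have hsum : ∑ r ∈ S, (ratIoo r).indicator (1 : ℝ → ℝ≥0∞) y = (F.card : ℝ≥0∞) := by
      simp [Set.indicator_apply, hF]
    rw [hsum] at hcon
    have hcard : 2 < F.card := by exact_mod_cast hcon
    have hne : F.Nonempty := Finset.card_pos.1 (by omega)
    obtain ⟨r₁, hr₁, hmin⟩ := F.exists_min_image (fun r => r.1) hne
    obtain ⟨r₂, hr₂, hmax⟩ := F.exists_max_image (fun r => r.2) hne
    obtain ⟨r₃, hr₃, h₃⟩ : ∃ r₃ ∈ F, r₃ ∉ ({r₁, r₂} : Finset (ℚ × ℚ)) := by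
      by_contra hall
      push Not at hall
      have := Finset.card_le_card (show F ⊆ {r₁, r₂} from hall)
      have := Finset.card_le_two (a := r₁) (b := r₂)
      omega
    simp only [Finset.mem_insert, Finset.mem_singleton, not_or] at h₃
    refine hS r₃ (Finset.mem_filter.1 hr₃).1 fun z hz => ?_
    have hy₁ := (Finset.mem_filter.1 hr₁)
    have hy₂ := (Finset.mem_filter.1 hr₂)
    have hle₁ : (r₁.1 : ℝ) ≤ r₃.1 := by exact_mod_cast hmin r₃ hr₃
    have hle₂ : (r₃.2 : ℝ) ≤ r₂.2 := by exact_mod_cast hmax r₃ hr₃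
    rcases le_total z y with hzy | hzy
    · exact mem_biUnion (x := r₁) (Finset.mem_coe.2
        (Finset.mem_erase.2 ⟨fun h => h₃.1 h.symm, hy₁.1⟩))
        ⟨hle₁.trans_lt hz.1, hzy.trans_lt hy₁.2.2⟩
    · exact mem_biUnion (x := r₂) (Finset.mem_coe.2
        (Finset.mem_erase.2 ⟨fun h => h₃.2 h.symm, hy₂.1⟩))
        ⟨hy₂.2.1.trans_le hzy, hz.2.trans_le hle₂⟩

lemma weak_type_finset (μ : Measure ℝ) {f : ℝ → ℝ≥0∞} (hf : Measurable f) (l : ℝ≥0∞)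
    (S : Finset (ℚ × ℚ)) (hS : ∀ r ∈ S, l * μ (ratIoo r) ≤ ∫⁻ y in ratIoo r, f y ∂μ) :
    l * μ (⋃ r ∈ S, ratIoo r) ≤ 2 * ∫⁻ y, f y ∂μ := by
  obtain ⟨T, hT, hU, hov⟩ := exists_subfamily_overlap_le_two S
  rw [hU]
  calc l * μ (⋃ r ∈ T, ratIoo r) ≤ l * ∑ r ∈ T, μ (ratIoo r) :=
        mul_le_mul_right (measure_biUnion_finset_le _ _) _
    _ = ∑ r ∈ T, l * μ (ratIoo r) := Finset.mul_sum _ _ _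
    _ ≤ ∑ r ∈ T, ∫⁻ y in ratIoo r, f y ∂μ := Finset.sum_le_sum fun r hr => hS r (hT hr)
    _ = ∑ r ∈ T, ∫⁻ y, (ratIoo r).indicator 1 y * f y ∂μ := by
        refine Finset.sum_congr rfl fun r _ => ?_
        rw [← lintegral_indicator (measurableSet_ratIoo r)]
        refine lintegral_congr fun y => ?_
        by_cases hy : y ∈ ratIoo r <;> simp [hy]
    _ = ∫⁻ y, ∑ r ∈ T, (ratIoo r).indicator 1 y * f y ∂μ := by
        rw [lintegral_finsetSum]
        intro r _
        exact (measurable_one.indicator (measurableSet_ratIoo r)).mul hf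
    _ ≤ ∫⁻ y, 2 * f y ∂μ := by
        refine lintegral_mono fun y => ?_
        rw [← Finset.sum_mul]
        exact mul_le_mul_left (hov y) _
    _ = _ := lintegral_const_mul _ hf

lemma weak_type_lineMax (μ : Measure ℝ) {f : ℝ → ℝ≥0∞} (hf : Measurable f) (l : ℝ≥0∞) :
    l * μ {s | l < lineMax μ f s} ≤ 2 * ∫⁻ y, f y ∂μ := by
  classical
  let P : ℚ × ℚ → Prop := fun r => l < (μ (ratIoo r))⁻¹ * ∫⁻ y in ratIoo r, f y ∂μ
  let U : Finset (ℚ × ℚ) → Set ℝ := fun S => ⋃ r ∈ S.filter P, ratIoo r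
  have hset : {s | l < lineMax μ f s} ⊆ ⋃ S, U S := by
    intro s hs
    obtain ⟨r, hr⟩ := lt_iSup_iff.1 (show l < lineMax μ f s from hs)
    by_cases hsr : s ∈ ratIoo r
    · rw [indicator_of_mem hsr] at hr
      refine mem_iUnion.2 ⟨{r}, mem_biUnion (x := r) ?_ hsr⟩
      simpa using hr
    · simp [hsr] at hr
  have hdir : Directed (· ⊆ ·) U := by
    refine Monotone.directed_le (f := U) fun S T hST => ?_
    exact biUnion_subset_biUnion_left (Finset.filter_subset_filter P hST)
  calc l * μ {s | l < lineMax μ f s} ≤ l * μ (⋃ S, U S) := mul_le_mul_right (measure_mono hset) _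
    _ = ⨆ S, l * μ (U S) := by rw [hdir.measure_iUnion, ENNReal.mul_iSup]
    _ ≤ _ := by
      refine iSup_le fun S => weak_type_finset μ hf l _ fun r hr => ?_
      have hr : P r := (Finset.mem_filter.1 hr).2
      simp only [P] at hr
      rcases eq_or_ne (μ (ratIoo r)) 0 with h0 | h0
      · simp [h0]
      rcases eq_or_ne (μ (ratIoo r)) ∞ with ht | ht
      · simp [ht] at hr
      · calc l * μ (ratIoo r)
            ≤ ((μ (ratIoo r))⁻¹ * ∫⁻ y in ratIoo r, f y ∂μ) * μ (ratIoo r) :=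
              mul_le_mul_left hr.le _
          _ = _ := by
              rw [mul_right_comm, ENNReal.inv_mul_cancel h0 ht, one_mul]

lemma lineMax_le_add (μ : Measure ℝ) {f g h : ℝ → ℝ≥0∞} (hg : Measurable g)
    (hfg : ∀ s, f s ≤ g s + h s) (s : ℝ) :
    lineMax μ f s ≤ lineMax μ g s + lineMax μ h s := by
  refine lineMax_le fun r hs => ?_
  calc _ ≤ (μ (ratIoo r))⁻¹ * ∫⁻ y in ratIoo r, (g y + h y) ∂μ :=
        mul_le_mul_right (lintegral_mono hfg) _
    _ = (μ (ratIoo r))⁻¹ * ∫⁻ y in ratIoo r, g y ∂μ +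
        (μ (ratIoo r))⁻¹ * ∫⁻ y in ratIoo r, h y ∂μ := by
        rw [lintegral_add_left hg, mul_add]
    _ ≤ _ := add_le_add (average_le_lineMax μ g hs) (average_le_lineMax μ h hs)

lemma lineMax_const_le (μ : Measure ℝ) (c : ℝ≥0∞) (s : ℝ) : lineMax μ (fun _ => c) s ≤ c := by
  refine lineMax_le fun r _ => ?_
  rw [lintegral_const, Measure.restrict_apply MeasurableSet.univ, univ_inter, mul_comm c,
    ← mul_assoc]
  exact mul_le_of_le_one_left zero_le (ENNReal.inv_mul_le_one _)

lemma truncated_weak_type (μ : Measure ℝ) {f : ℝ → ℝ≥0∞} (hf : Measurable f) (l : ℝ≥0∞) :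
    l * μ {s | l < lineMax μ f s} ≤ 4 * ∫⁻ y, {y | l < 2 * f y}.indicator f y ∂μ := by
  have hm : MeasurableSet {y | l < 2 * f y} := measurableSet_lt measurable_const (hf.const_mul 2)
  have hsub : {s | l < lineMax μ f s} ⊆
      {s | l / 2 < lineMax μ ({y | l < 2 * f y}.indicator f) s} := by
    intro s hs
    by_contra hcon
    simp only [mem_ofPred_eq, not_lt] at hcon hs
    refine absurd hs (not_lt.2 ?_)
    calc lineMax μ f s ≤ lineMax μ ({y | l < 2 * f y}.indicator f) s +
          lineMax μ (fun _ => l / 2) s := by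
          refine lineMax_le_add μ (hf.indicator hm) (fun y => ?_) s
          by_cases hy : l < 2 * f y
          · simp [hy]
          · simp only [mem_ofPred_eq, hy, not_false_eq_true, indicator_of_notMem, zero_add]
            rw [ENNReal.le_div_iff_mul_le (by simp) (by simp), mul_comm]
            exact not_lt.1 hy
      _ ≤ l / 2 + l / 2 := add_le_add hcon (lineMax_const_le _ _ _)
      _ = l := ENNReal.add_halves l
  calc l * μ {s | l < lineMax μ f s}
      ≤ l * μ {s | l / 2 < lineMax μ ({y | l < 2 * f y}.indicator f) s} :=
        mul_le_mul_right (measure_mono hsub) _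
    _ = 2 * (l / 2 * μ {s | l / 2 < lineMax μ ({y | l < 2 * f y}.indicator f) s}) := by
        rw [← mul_assoc, ENNReal.mul_div_cancel (by simp) (by simp)]
    _ ≤ 2 * (2 * ∫⁻ y, {y | l < 2 * f y}.indicator f y ∂μ) :=
        mul_le_mul_right (weak_type_lineMax μ (hf.indicator hm) _) _
    _ = _ := by rw [← mul_assoc]; norm_num

/-- The maximal operator over intervals is bounded on `L^p(μ)` for every measure `μ` on the line. -/
lemma exists_strong_type_lineMax {p : ℝ} (hp : 1 < p) :
    ∃ C : ℝ≥0∞, C ≠ ∞ ∧ ∀ (μ : Measure ℝ) (f : ℝ → ℝ≥0∞), Measurable f →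
      ∫⁻ s, lineMax μ f s ^ p ∂μ ≤ C * ∫⁻ s, f s ^ p ∂μ := by
  set d := p - 1 with hd
  have hd0 : 0 < d := by linarith
  set G := ∑' m : ℤ, (2 : ℝ≥0∞) ^ (-(d * |(m : ℝ)|)) with hG
  set D := 2 ^ (2 * d) * G with hD
  have hDt : D ≠ ∞ := ENNReal.mul_ne_top (two_rpow_ne_top _) (tsum_int_two_rpow_ne_top hd0)
  have hD0 : D ≠ 0 := by
    refine mul_ne_zero (two_rpow_ne_zero _) fun h => ?_
    have := ENNReal.tsum_eq_zero.1 h 0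
    simp at this
  refine ⟨2 ^ p * 4 * D, ENNReal.mul_ne_top (ENNReal.mul_ne_top (two_rpow_ne_top _) (by simp)) hDt,
    fun μ f hf => ?_⟩
  have hpw : ∀ y, ∑' k : ℤ, (if (2 : ℝ≥0∞) ^ (k : ℝ) < 2 * f y then
      (2 : ℝ≥0∞) ^ ((k : ℝ) * d) else 0) * f y ≤ D * f y ^ p := by
    intro y
    rcases eq_or_ne (f y) ∞ with ht | ht
    · rw [ht, ENNReal.top_rpow_of_pos (by linarith), ENNReal.mul_top hD0]
      exact le_top
    rcases eq_or_ne (f y) 0 with h0 | h0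
    · simp [h0]
    rw [ENNReal.tsum_mul_right]
    calc _ ≤ D * f y ^ d * f y := mul_le_mul_left (tsum_layers_le hd0 ht) _
      _ = D * f y ^ p := by
        rw [mul_assoc]
        congr 1
        nth_rw 2 [← ENNReal.rpow_one (f y)]
        rw [← ENNReal.rpow_add _ _ h0 ht]
        congr 1
        ring
  have hlm := measurable_lineMax μ f
  have hms : ∀ k : ℤ, MeasurableSet {s | (2 : ℝ≥0∞) ^ (k : ℝ) < lineMax μ f s} := fun k =>
    measurableSet_lt measurable_const hlm
  calc ∫⁻ s, lineMax μ f s ^ p ∂μ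
      ≤ ∫⁻ s, ∑' k : ℤ, (if (2 : ℝ≥0∞) ^ (k : ℝ) < lineMax μ f s then
          (2 : ℝ≥0∞) ^ (((k : ℝ) + 1) * p) else 0) ∂μ :=
        lintegral_mono fun s => rpow_le_tsum_layers (by linarith) _
    _ = ∑' k : ℤ, ∫⁻ s, (if (2 : ℝ≥0∞) ^ (k : ℝ) < lineMax μ f s then
          (2 : ℝ≥0∞) ^ (((k : ℝ) + 1) * p) else 0) ∂μ :=
        lintegral_tsum fun k => (Measurable.ite (hms k) measurable_const
          measurable_const).aemeasurable
    _ = ∑' k : ℤ, (2 : ℝ≥0∞) ^ (((k : ℝ) + 1) * p) *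
          μ {s | (2 : ℝ≥0∞) ^ (k : ℝ) < lineMax μ f s} := by
        refine tsum_congr fun k => ?_
        rw [← lintegral_indicator_const (hms k)]
        refine lintegral_congr fun s => ?_
        simp only [indicator_apply, mem_ofPred_eq]
    _ ≤ ∑' k : ℤ, 2 ^ p * 4 * ∫⁻ y, (if (2 : ℝ≥0∞) ^ (k : ℝ) < 2 * f y then
          (2 : ℝ≥0∞) ^ ((k : ℝ) * d) else 0) * f y ∂μ := by
        refine ENNReal.tsum_le_tsum fun k => ?_
        have e : (2 : ℝ≥0∞) ^ (((k : ℝ) + 1) * p) = 2 ^ p * 2 ^ ((k : ℝ) * d) * 2 ^ (k : ℝ) := by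
          rw [← two_rpow_add, ← two_rpow_add]
          congr 1
          rw [hd]; ring
        rw [e, mul_assoc, mul_assoc, mul_assoc]
        refine mul_le_mul_right ?_ _
        calc _ ≤ (2 : ℝ≥0∞) ^ ((k : ℝ) * d) *
              (4 * ∫⁻ y, {y | (2 : ℝ≥0∞) ^ (k : ℝ) < 2 * f y}.indicator f y ∂μ) :=
              mul_le_mul_right (truncated_weak_type μ hf _) _
          _ = 4 * ((2 : ℝ≥0∞) ^ ((k : ℝ) * d) *
              ∫⁻ y, {y | (2 : ℝ≥0∞) ^ (k : ℝ) < 2 * f y}.indicator f y ∂μ) := by ring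
          _ = _ := by
              rw [← lintegral_const_mul _ (hf.indicator
                (measurableSet_lt measurable_const (hf.const_mul 2)))]
              congr 1
              refine lintegral_congr fun y => ?_
              simp only [indicator_apply, mem_ofPred_eq]
              split_ifs <;> simp
    _ = 2 ^ p * 4 * ∫⁻ y, ∑' k : ℤ, (if (2 : ℝ≥0∞) ^ (k : ℝ) < 2 * f y then
          (2 : ℝ≥0∞) ^ ((k : ℝ) * d) else 0) * f y ∂μ := by
        rw [ENNReal.tsum_mul_left, lintegral_tsum]
        intro k
        exact ((Measurable.ite (measurableSet_lt measurable_const (hf.const_mul 2))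
          measurable_const measurable_const).mul hf).aemeasurable
    _ ≤ 2 ^ p * 4 * ∫⁻ y, D * f y ^ p ∂μ := mul_le_mul_right (lintegral_mono hpw) _
    _ = _ := by
        rw [lintegral_const_mul _ (hf.pow_const p)]
        ring

/-! ### Muckenhoupt weights in factored form -/

/-- The exponential with values in `ℝ≥0∞`, a parametrization of `(0, ∞)`. -/
def expE (x : ℝ) : ℝ≥0∞ := ENNReal.ofReal (Real.exp x)

lemma expE_ne_zero (x : ℝ) : expE x ≠ 0 := by
  simp [expE, Real.exp_pos]

lemma expE_ne_top (x : ℝ) : expE x ≠ ∞ := ENNReal.ofReal_ne_top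

lemma expE_mul (x y : ℝ) : expE x * expE y = expE (x + y) := by
  rw [expE, expE, expE, ← ENNReal.ofReal_mul (Real.exp_pos _).le, Real.exp_add]

lemma expE_rpow (x y : ℝ) : expE x ^ y = expE (x * y) := by
  rw [expE, expE, ENNReal.ofReal_rpow_of_pos (Real.exp_pos _), Real.exp_mul]

lemma expE_inv (x : ℝ) : (expE x)⁻¹ = expE (-x) := by
  rw [← ENNReal.rpow_neg_one, expE_rpow]
  congr 1
  ring

lemma expE_zero : expE 0 = 1 := by simp [expE]

lemma exists_eq_expE {a : ℝ≥0∞} (h0 : a ≠ 0) (ht : a ≠ ∞) : ∃ x, a = expE x := by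
  refine ⟨Real.log a.toReal, ?_⟩
  rw [expE, Real.exp_log (ENNReal.toReal_pos h0 ht), ENNReal.ofReal_toReal ht]

lemma rpow_le_rpow_of_exponent_nonpos {x y : ℝ≥0∞} {z : ℝ} (hz : z ≤ 0) (h : x ≤ y) :
    y ^ z ≤ x ^ z := by
  rw [← neg_neg z, ENNReal.rpow_neg y, ENNReal.rpow_neg x, ENNReal.inv_le_inv]
  exact ENNReal.rpow_le_rpow h (by linarith)

/-- Weights satisfying the `A₁` condition with constant `K`. -/
structure IsA1 (K : ℝ≥0∞) (v : ℝ → ℝ≥0∞) : Prop where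
  measurable : Measurable v
  ne_zero : ∀ᵐ s, v s ≠ 0
  ne_top : ∀ᵐ s, v s ≠ ∞
  lineMax_le : ∀ s, lineMax volume v s ≤ K * v s

lemma isA1_one : IsA1 1 (fun _ => 1) where
  measurable := measurable_const
  ne_zero := by simp
  ne_top := by simp
  lineMax_le s := by simpa using lineMax_const_le volume 1 s

lemma IsA1.mono {K K' : ℝ≥0∞} {v : ℝ → ℝ≥0∞} (h : IsA1 K v) (hK : K ≤ K') : IsA1 K' v where
  measurable := h.measurable
  ne_zero := h.ne_zero
  ne_top := h.ne_top
  lineMax_le s := (h.lineMax_le s).trans (mul_le_mul_left hK _)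

lemma IsA1.ae_expE {K : ℝ≥0∞} {v : ℝ → ℝ≥0∞} (h : IsA1 K v) : ∀ᵐ s, ∃ x, v s = expE x := by
  filter_upwards [h.ne_zero, h.ne_top] with s h0 ht using exists_eq_expE h0 ht

/-- The `A_p` weight with factors `v₀` and `v₁`. -/
def apWeight (v₀ v₁ : ℝ → ℝ≥0∞) (p : ℝ) (s : ℝ) : ℝ≥0∞ := v₀ s * v₁ s ^ (1 - p)

lemma measurable_apWeight {v₀ v₁ : ℝ → ℝ≥0∞} (h₀ : Measurable v₀) (h₁ : Measurable v₁) (p : ℝ) :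
    Measurable (apWeight v₀ v₁ p) := h₀.mul (h₁.pow_const _)

lemma volume_ratIoo_ne_zero {r : ℚ × ℚ} {s : ℝ} (hs : s ∈ ratIoo r) : volume (ratIoo r) ≠ 0 := by
  have : r.1 < r.2 := by exact_mod_cast hs.1.trans hs.2
  simp [ratIoo, Real.volume_Ioo, this]

lemma volume_ratIoo_ne_top (r : ℚ × ℚ) : volume (ratIoo r) ≠ ∞ := by
  simp [ratIoo, Real.volume_Ioo]

lemma IsA1.average_eq {K : ℝ≥0∞} (hK : K ≠ ∞) {v : ℝ → ℝ≥0∞} (h : IsA1 K v) {r : ℚ × ℚ} {s : ℝ}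
    (hs : s ∈ ratIoo r) :
    ∃ b, (volume (ratIoo r))⁻¹ * ∫⁻ y in ratIoo r, v y = expE b ∧
      ∀ x ∈ ratIoo r, expE b ≤ K * v x := by
  have hle : ∀ x ∈ ratIoo r, (volume (ratIoo r))⁻¹ * ∫⁻ y in ratIoo r, v y ≤ K * v x :=
    fun x hx => (average_le_lineMax _ _ hx).trans (h.lineMax_le x)
  have hvol := volume_ratIoo_ne_zero hs
  obtain ⟨b, hb⟩ : ∃ b, (volume (ratIoo r))⁻¹ * ∫⁻ y in ratIoo r, v y = expE b := by
    refine exists_eq_expE (mul_ne_zero (ENNReal.inv_ne_zero.2 (volume_ratIoo_ne_top r)) ?_) ?_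
    · intro h0
      rw [lintegral_eq_zero_iff h.measurable] at h0
      have h1 := ae_restrict_of_ae (s := ratIoo r) h.ne_zero
      have h2 : ∀ᵐ _ ∂(volume.restrict (ratIoo r)), False := by
        filter_upwards [h0, h1] with x hx hx'
        exact hx' hx
      rw [Filter.eventually_false_iff_eq_bot, ae_eq_bot, Measure.restrict_eq_zero] at h2
      exact hvol h2
    · by_contra htop
      have h2 : volume (ratIoo r) = 0 := by
        refine measure_mono_null (fun x hx => ?_) (ae_iff.1 h.ne_top)
        have := hle x hx
        rw [htop, top_le_iff, ENNReal.mul_eq_top] at this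
        exact fun hv => hv (by simpa [hK] using this.resolve_right (by simp [hK]) |>.2)
      exact hvol h2
  exact ⟨b, hb, fun x hx => hb ▸ hle x hx⟩

lemma average_apWeight_le {k : ℝ} {v₀ v₁ : ℝ → ℝ≥0∞} (h₀ : Measurable v₀) {p a b : ℝ} (hp : 1 < p)
    {r : ℚ × ℚ} (ha : (volume (ratIoo r))⁻¹ * ∫⁻ y in ratIoo r, v₀ y = expE a)
    (hb : ∀ x ∈ ratIoo r, expE b ≤ expE k * v₁ x) :
    (volume (ratIoo r))⁻¹ * ∫⁻ y in ratIoo r, apWeight v₀ v₁ p y ≤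
      expE (a + (b - k) * (1 - p)) := by
  have hb' : ∀ x ∈ ratIoo r, expE (b - k) ≤ v₁ x := by
    intro x hx
    calc expE (b - k) = (expE k)⁻¹ * expE b := by rw [expE_inv, expE_mul]; ring_nf
      _ ≤ (expE k)⁻¹ * (expE k * v₁ x) := mul_le_mul_right (hb x hx) _
      _ = v₁ x := by
        rw [← mul_assoc, ENNReal.inv_mul_cancel (expE_ne_zero k) (expE_ne_top k), one_mul]
  calc _ ≤ (volume (ratIoo r))⁻¹ * ∫⁻ y in ratIoo r, v₀ y * expE (b - k) ^ (1 - p) := by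
        refine mul_le_mul_right (setLIntegral_mono' (measurableSet_ratIoo r) fun x hx => ?_) _
        exact mul_le_mul_right (rpow_le_rpow_of_exponent_nonpos (by linarith) (hb' x hx)) _
    _ = _ := by
        rw [lintegral_mul_const _ h₀, ← mul_assoc, ha, expE_rpow, expE_mul]

lemma apWeight_ae_expE {K : ℝ≥0∞} {v₀ v₁ : ℝ → ℝ≥0∞} (h₀ : IsA1 K v₀) (h₁ : IsA1 K v₁) :
    ∀ᵐ s, ∃ a b, v₀ s = expE a ∧ v₁ s = expE b ∧
      ∀ p, apWeight v₀ v₁ p s = expE (a + b * (1 - p)) := by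
  filter_upwards [h₀.ae_expE, h₁.ae_expE] with s ⟨a, ha⟩ ⟨b, hb⟩
  refine ⟨a, b, ha, hb, fun p => ?_⟩
  rw [apWeight, ha, hb, expE_rpow, expE_mul]

/-- The `A_p` condition for products of `A₁` weights. -/
lemma average_apWeight_mul_le {K : ℝ≥0∞} (hK : K ≠ ∞) {v₀ v₁ : ℝ → ℝ≥0∞} (h₀ : IsA1 K v₀)
    (h₁ : IsA1 K v₁) {p : ℝ} (hp : 1 < p) {r : ℚ × ℚ} {s : ℝ} (hs : s ∈ ratIoo r) :
    ((volume (ratIoo r))⁻¹ * ∫⁻ y in ratIoo r, apWeight v₀ v₁ p y) *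
      ((volume (ratIoo r))⁻¹ * ∫⁻ y in ratIoo r, apWeight v₁ v₀ (p / (p - 1)) y) ^ (p - 1) ≤
        K ^ p ∧
      ∫⁻ y in ratIoo r, apWeight v₀ v₁ p y ≠ ∞ ∧
      ∫⁻ y in ratIoo r, apWeight v₁ v₀ (p / (p - 1)) y ≠ ∞ := by
  obtain ⟨a, ha, ha'⟩ := h₀.average_eq hK hs
  obtain ⟨b, hb, hb'⟩ := h₁.average_eq hK hs
  have hK0 : K ≠ 0 := by
    rintro rfl
    exact expE_ne_zero a (by simpa using ha' s hs)
  obtain ⟨k, rfl⟩ := exists_eq_expE hK0 hK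
  have hp' : 1 < p / (p - 1) := by
    rw [lt_div_iff₀ (by linarith)]; linarith
  have i1 := average_apWeight_le h₀.measurable hp ha hb'
  have i2 := average_apWeight_le h₁.measurable hp' hb ha'
  have fin : ∀ (J : ℝ≥0∞) (x : ℝ), (volume (ratIoo r))⁻¹ * J ≤ expE x → J ≠ ∞ := by
    rintro J x hJ rfl
    rw [ENNReal.mul_top (ENNReal.inv_ne_zero.2 (volume_ratIoo_ne_top r)), top_le_iff] at hJ
    exact expE_ne_top _ hJ
  refine ⟨?_, fin _ _ i1, fin _ _ i2⟩
  calc _ ≤ expE (a + (b - k) * (1 - p)) * expE (b + (a - k) * (1 - p / (p - 1))) ^ (p - 1) :=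
        mul_le_mul' i1 (ENNReal.rpow_le_rpow i2 (by linarith))
    _ = expE k ^ p := by
        rw [expE_rpow, expE_rpow, expE_mul]
        congr 1
        have : p - 1 ≠ 0 := by linarith
        field_simp
        ring

lemma setLIntegral_apWeight_ne_zero {K : ℝ≥0∞} {v₀ v₁ : ℝ → ℝ≥0∞} (h₀ : IsA1 K v₀)
    (h₁ : IsA1 K v₁) (p : ℝ) {r : ℚ × ℚ} {s : ℝ} (hs : s ∈ ratIoo r) :
    ∫⁻ y in ratIoo r, apWeight v₀ v₁ p y ≠ 0 := by
  intro h0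
  rw [lintegral_eq_zero_iff (measurable_apWeight h₀.measurable h₁.measurable p)] at h0
  have h1 := ae_restrict_of_ae (s := ratIoo r) (apWeight_ae_expE h₀ h₁)
  have h2 : ∀ᵐ _ ∂(volume.restrict (ratIoo r)), False := by
    filter_upwards [h0, h1] with x hx ⟨a, b, _, _, h⟩
    rw [h] at hx
    exact expE_ne_zero _ hx
  rw [Filter.eventually_false_iff_eq_bot, ae_eq_bot, Measure.restrict_eq_zero] at h2
  exact volume_ratIoo_ne_zero hs h2

/-- Pointwise control of the maximal function by weighted maximal functions. -/
lemma lineMax_rpow_le {K : ℝ≥0∞} (hK : K ≠ ∞) {v₀ v₁ : ℝ → ℝ≥0∞} (h₀ : IsA1 K v₀)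
    (h₁ : IsA1 K v₁) {p : ℝ} (hp : 1 < p) {f : ℝ → ℝ≥0∞} (hf : Measurable f) (s : ℝ) :
    lineMax volume f s ^ (p - 1) ≤ K ^ p * lineMax (volume.withDensity (apWeight v₀ v₁ p))
      (fun x => lineMax (volume.withDensity (apWeight v₁ v₀ (p / (p - 1))))
        (fun y => f y * (apWeight v₁ v₀ (p / (p - 1)) y)⁻¹) x ^ (p - 1) *
          (apWeight v₀ v₁ p x)⁻¹) s := by
  set w := apWeight v₀ v₁ p with hw
  set σ := apWeight v₁ v₀ (p / (p - 1)) with hσ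
  have hwm : Measurable w := measurable_apWeight h₀.measurable h₁.measurable p
  have hσm : Measurable σ := measurable_apWeight h₁.measurable h₀.measurable _
  set h : ℝ → ℝ≥0∞ := fun y => f y * (σ y)⁻¹ with hh
  have hhm : Measurable h := hf.mul hσm.inv
  set g : ℝ → ℝ≥0∞ := fun x => lineMax (volume.withDensity σ) h x ^ (p - 1) * (w x)⁻¹ with hg
  have hgm : Measurable g := ((measurable_lineMax _ _).pow_const _).mul hwm.inv
  have hp0 : 0 < p - 1 := by linarith
  rw [← ENNReal.le_rpow_inv_iff hp0]
  refine lineMax_le fun r hs => ?_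
  rw [ENNReal.le_rpow_inv_iff hp0]
  obtain ⟨hA, hwt, hσt⟩ := average_apWeight_mul_le hK h₀ h₁ hp hs
  have hw0 := setLIntegral_apWeight_ne_zero h₀ h₁ p hs
  have hσ0 := setLIntegral_apWeight_ne_zero h₁ h₀ (p / (p - 1)) hs
  rw [← hw] at hA hwt hw0
  rw [← hσ] at hA hσt hσ0
  have hwI : (volume.withDensity w) (ratIoo r) = ∫⁻ y in ratIoo r, w y :=
    withDensity_apply _ (measurableSet_ratIoo r)
  have hσI : (volume.withDensity σ) (ratIoo r) = ∫⁻ y in ratIoo r, σ y :=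
    withDensity_apply _ (measurableSet_ratIoo r)
  set m := volume (ratIoo r) with hm
  have hm0 : m ≠ 0 := volume_ratIoo_ne_zero hs
  have hmt : m ≠ ∞ := volume_ratIoo_ne_top r
  set W := ∫⁻ y in ratIoo r, w y with hW
  set S := ∫⁻ y in ratIoo r, σ y with hS
  have hfint : ∫⁻ y in ratIoo r, f y = ∫⁻ y in ratIoo r, h y ∂(volume.withDensity σ) := by
    rw [restrict_withDensity (measurableSet_ratIoo r),
      lintegral_withDensity_eq_lintegral_mul _ hσm hhm]
    refine lintegral_congr_ae (ae_restrict_of_ae ?_)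
    filter_upwards [apWeight_ae_expE h₁ h₀] with y ⟨a, b, _, _, hab⟩
    simp only [Pi.mul_apply, hh, hσ, hab]
    rw [mul_comm, mul_assoc, ENNReal.inv_mul_cancel (expE_ne_zero _) (expE_ne_top _), mul_one]
  set L := S⁻¹ * ∫⁻ y in ratIoo r, h y ∂(volume.withDensity σ) with hL
  have hLS : L * S = ∫⁻ y in ratIoo r, f y := by
    rw [hfint, hL, mul_right_comm, ENNReal.inv_mul_cancel hσ0 hσt, one_mul]
  have hLm : L ^ (p - 1) * m ≤ ∫⁻ y in ratIoo r, g y ∂(volume.withDensity w) := by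
    rw [restrict_withDensity (measurableSet_ratIoo r),
      lintegral_withDensity_eq_lintegral_mul _ hwm hgm]
    calc L ^ (p - 1) * m = ∫⁻ _ in ratIoo r, L ^ (p - 1) := by rw [setLIntegral_const]
      _ ≤ ∫⁻ x in ratIoo r, lineMax (volume.withDensity σ) h x ^ (p - 1) := by
        refine setLIntegral_mono' (measurableSet_ratIoo r) fun x hx => ?_
        refine ENNReal.rpow_le_rpow ?_ hp0.le
        rw [hL, ← hσI]
        exact average_le_lineMax _ _ hx
      _ = _ := by
        refine lintegral_congr_ae (ae_restrict_of_ae ?_)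
        filter_upwards [apWeight_ae_expE h₀ h₁] with y ⟨a, b, _, _, hab⟩
        simp only [Pi.mul_apply, hg, hw, hab]
        rw [mul_comm, mul_assoc, ENNReal.inv_mul_cancel (expE_ne_zero _) (expE_ne_top _), mul_one]
  calc (m⁻¹ * ∫⁻ y in ratIoo r, f y) ^ (p - 1) = L ^ (p - 1) * (m⁻¹ * S) ^ (p - 1) := by
        rw [← hLS, ← ENNReal.mul_rpow_of_nonneg _ _ hp0.le]
        ring_nf
    _ = (L ^ (p - 1) * m) * (m⁻¹ * (m⁻¹ * S) ^ (p - 1)) := by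
        rw [mul_assoc, ← mul_assoc m, ENNReal.mul_inv_cancel hm0 hmt, one_mul]
    _ ≤ (∫⁻ y in ratIoo r, g y ∂(volume.withDensity w)) * (m⁻¹ * (m⁻¹ * S) ^ (p - 1)) :=
        mul_le_mul_left hLm _
    _ = ((m⁻¹ * W) * (m⁻¹ * S) ^ (p - 1)) *
          (W⁻¹ * ∫⁻ y in ratIoo r, g y ∂(volume.withDensity w)) := by
        calc _ = (W * W⁻¹) * ((∫⁻ y in ratIoo r, g y ∂(volume.withDensity w)) *
              (m⁻¹ * (m⁻¹ * S) ^ (p - 1))) := by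
              rw [ENNReal.mul_inv_cancel hw0 hwt, one_mul]
          _ = _ := by ring
    _ ≤ _ := by
        refine mul_le_mul' hA ?_
        rw [← hwI]
        exact average_le_lineMax _ _ hs

/-- Weighted bound for the maximal operator on the line. -/
lemma exists_weighted_lineMax {p : ℝ} (hp : 1 < p) {K : ℝ≥0∞} (hK : K ≠ ∞) :
    ∃ C : ℝ≥0∞, C ≠ ∞ ∧ ∀ v₀ v₁, IsA1 K v₀ → IsA1 K v₁ → ∀ f : ℝ → ℝ≥0∞, Measurable f →
      ∫⁻ s, lineMax volume f s ^ p * apWeight v₀ v₁ p s ≤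
        C * ∫⁻ s, f s ^ p * apWeight v₀ v₁ p s := by
  have hp0 : 0 < p - 1 := by linarith
  set p' := p / (p - 1) with hp'
  have hp'1 : 1 < p' := by
    rw [hp', lt_div_iff₀ (by linarith)]; linarith
  obtain ⟨C₁, hC₁, H₁⟩ := exists_strong_type_lineMax hp'1
  obtain ⟨C₂, hC₂, H₂⟩ := exists_strong_type_lineMax hp
  refine ⟨(K ^ p) ^ p' * C₁ * C₂, ENNReal.mul_ne_top (ENNReal.mul_ne_top ?_ hC₁) hC₂,
    fun v₀ v₁ h₀ h₁ f hf => ?_⟩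
  · exact ENNReal.rpow_ne_top_of_nonneg (by linarith)
      (ENNReal.rpow_ne_top_of_nonneg (by linarith) hK)
  set w := apWeight v₀ v₁ p with hw
  set σ := apWeight v₁ v₀ p' with hσ
  have hwm : Measurable w := measurable_apWeight h₀.measurable h₁.measurable p
  have hσm : Measurable σ := measurable_apWeight h₁.measurable h₀.measurable _
  set h : ℝ → ℝ≥0∞ := fun y => f y * (σ y)⁻¹ with hh
  have hhm : Measurable h := hf.mul hσm.inv
  have hMm := measurable_lineMax (volume.withDensity σ) h
  set g : ℝ → ℝ≥0∞ := fun x => lineMax (volume.withDensity σ) h x ^ (p - 1) * (w x)⁻¹ with hg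
  have hgm : Measurable g := ((measurable_lineMax _ _).pow_const _).mul hwm.inv
  have e : (p - 1) * p' = p := by
    rw [hp']; field_simp
  have hpt : ∀ s, lineMax volume f s ^ p ≤
      (K ^ p) ^ p' * lineMax (volume.withDensity w) g s ^ p' := by
    intro s
    rw [← ENNReal.mul_rpow_of_nonneg _ _ (by linarith : 0 ≤ p')]
    calc lineMax volume f s ^ p = (lineMax volume f s ^ (p - 1)) ^ p' := by
          rw [← ENNReal.rpow_mul, e]
      _ ≤ _ := ENNReal.rpow_le_rpow (lineMax_rpow_le hK h₀ h₁ hp hf s) (by linarith)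
  calc ∫⁻ s, lineMax volume f s ^ p * w s
      ≤ ∫⁻ s, (K ^ p) ^ p' * (w s * lineMax (volume.withDensity w) g s ^ p') := by
        refine lintegral_mono fun s => ?_
        calc _ ≤ (K ^ p) ^ p' * lineMax (volume.withDensity w) g s ^ p' * w s :=
              mul_le_mul_left (hpt s) _
          _ = _ := by ring
    _ = (K ^ p) ^ p' * ∫⁻ s, lineMax (volume.withDensity w) g s ^ p' ∂(volume.withDensity w) := by
        rw [lintegral_const_mul _ (by exact hwm.mul ((measurable_lineMax _ _).pow_const _)),
          lintegral_withDensity_eq_lintegral_mul _ hwm ((measurable_lineMax _ _).pow_const _)]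
        rfl
    _ ≤ (K ^ p) ^ p' * (C₁ * ∫⁻ s, g s ^ p' ∂(volume.withDensity w)) :=
        mul_le_mul_right (H₁ _ _ hgm) _
    _ = (K ^ p) ^ p' * (C₁ * ∫⁻ s, lineMax (volume.withDensity σ) h s ^ p
          ∂(volume.withDensity σ)) := by
        congr 2
        rw [lintegral_withDensity_eq_lintegral_mul _ hwm (hgm.pow_const _),
          lintegral_withDensity_eq_lintegral_mul _ hσm (hMm.pow_const _)]
        refine lintegral_congr_ae ?_
        filter_upwards [h₀.ae_expE, h₁.ae_expE] with s ⟨a, ha⟩ ⟨b, hb⟩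
        simp only [Pi.mul_apply, hg, hw, hσ, apWeight, ha, hb]
        rw [ENNReal.mul_rpow_of_nonneg _ _ (by linarith : 0 ≤ p'), ← ENNReal.rpow_mul, e]
        rw [mul_left_comm, mul_comm]
        congr 1
        simp only [expE_rpow, expE_mul, expE_inv]
        congr 1
        rw [hp']
        field_simp
        ring
    _ ≤ (K ^ p) ^ p' * (C₁ * (C₂ * ∫⁻ s, h s ^ p ∂(volume.withDensity σ))) :=
        mul_le_mul_right (mul_le_mul_right (H₂ _ _ hhm) _) _
    _ = (K ^ p) ^ p' * (C₁ * (C₂ * ∫⁻ s, f s ^ p * w s)) := by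
        congr 3
        rw [lintegral_withDensity_eq_lintegral_mul _ hσm (hhm.pow_const _)]
        refine lintegral_congr_ae ?_
        filter_upwards [h₀.ae_expE, h₁.ae_expE] with s ⟨a, ha⟩ ⟨b, hb⟩
        simp only [Pi.mul_apply, hh, hw, hσ, apWeight, ha, hb]
        rw [ENNReal.mul_rpow_of_nonneg _ _ (by linarith : 0 ≤ p), mul_left_comm]
        congr 1
        simp only [expE_rpow, expE_mul, expE_inv]
        congr 1
        rw [hp']
        field_simp
        ring
    _ = _ := by ring

/-! ### The Rubio de Francia iteration and extrapolation -/

lemma lineMax_tsum_le (μ : Measure ℝ) {c : ℕ → ℝ≥0∞} {u : ℕ → ℝ → ℝ≥0∞}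
    (hu : ∀ k, Measurable (u k)) (s : ℝ) :
    lineMax μ (fun y => ∑' k, c k * u k y) s ≤ ∑' k, c k * lineMax μ (u k) s := by
  refine lineMax_le fun r hs => ?_
  rw [lintegral_tsum fun k => ((hu k).const_mul _).aemeasurable, ← ENNReal.tsum_mul_left]
  refine ENNReal.tsum_le_tsum fun k => ?_
  rw [lintegral_const_mul _ (hu k), mul_left_comm]
  exact mul_le_mul_right (average_le_lineMax μ (u k) hs) _

lemma measurable_rpow_mul {f w : ℝ → ℝ≥0∞} (hf : Measurable f) (hw : Measurable w) (t : ℝ) :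
    Measurable fun s => f s ^ t * w s :=
  (hf.pow_const t).mul hw

lemma lineMax_ne_zero {u : ℝ → ℝ≥0∞} (hu : Measurable u) (h : ¬ u =ᵐ[volume] 0) (s : ℝ) :
    lineMax volume u s ≠ 0 := by
  intro h0
  apply h
  have key : ∀ r : ℚ × ℚ, s ∈ ratIoo r → ∀ᵐ y, y ∈ ratIoo r → u y = 0 := by
    intro r hs
    have h1 := average_le_lineMax volume u hs
    rw [h0, nonpos_iff_eq_zero, mul_eq_zero] at h1
    have h2 := h1.resolve_left (ENNReal.inv_ne_zero.2 (volume_ratIoo_ne_top r))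
    rw [lintegral_eq_zero_iff hu] at h2
    exact (ae_restrict_iff' (measurableSet_ratIoo r)).1 h2
  have all : ∀ᵐ y, ∀ r : ℚ × ℚ, s ∈ ratIoo r → y ∈ ratIoo r → u y = 0 := by
    rw [ae_all_iff]
    intro r
    by_cases hs : s ∈ ratIoo r
    · filter_upwards [key r hs] with y hy _ using hy
    · exact ae_of_all _ fun y h => absurd h hs
  filter_upwards [all] with y hy
  obtain ⟨a, ha⟩ := exists_rat_lt (min s y)
  obtain ⟨b, hb⟩ := exists_rat_gt (max s y)
  exact hy (a, b) ⟨ha.trans_le (min_le_left _ _), (le_max_left _ _).trans_lt hb⟩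
    ⟨ha.trans_le (min_le_right _ _), (le_max_right _ _).trans_lt hb⟩

lemma exists_isA1_majorant {t : ℝ} (ht : 1 < t) {K : ℝ≥0∞} (hK : K ≠ ∞) :
    ∃ K' : ℝ≥0∞, K' ≠ ∞ ∧ ∀ v₀ v₁, IsA1 K v₀ → IsA1 K v₁ → ∀ u : ℝ → ℝ≥0∞, Measurable u →
      ∫⁻ s, u s ^ t * apWeight v₀ v₁ t s ≠ 0 → ∫⁻ s, u s ^ t * apWeight v₀ v₁ t s ≠ ∞ →
      ∃ V, IsA1 K' V ∧ (∀ s, u s ≤ V s) ∧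
        ∫⁻ s, V s ^ t * apWeight v₀ v₁ t s ≤
          2 ^ t * 2 * ∫⁻ s, u s ^ t * apWeight v₀ v₁ t s := by
  have ht0 : 0 < t := by linarith
  obtain ⟨C₀, hC₀, H₀⟩ := exists_weighted_lineMax ht hK
  obtain ⟨x, hx⟩ := exists_eq_expE (a := C₀ + 1) (by simp) (by simp [hC₀])
  set c := expE (-(x / t)) * 4⁻¹ with hc
  have hc0 : c ≠ 0 := mul_ne_zero (expE_ne_zero _) (by simp)
  have hct : c ≠ ∞ := ENNReal.mul_ne_top (expE_ne_top _) (by simp)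
  have hcC : (2 * c) ^ t * expE x ≤ 2⁻¹ := by
    have e : 2 * c = expE (-(x / t)) * 2⁻¹ := by
      rw [hc, mul_left_comm]
      congr 1
      rw [show (4 : ℝ≥0∞) = 2 * 2 by norm_num, ENNReal.mul_inv (by simp) (by simp), ← mul_assoc,
        ENNReal.mul_inv_cancel (by simp) (by simp), one_mul]
    rw [e, ENNReal.mul_rpow_of_nonneg _ _ ht0.le, expE_rpow, mul_right_comm, expE_mul]
    have : -(x / t) * t + x = 0 := by field_simp; ring
    rw [this, expE_zero, one_mul]
    calc (2⁻¹ : ℝ≥0∞) ^ t ≤ 2⁻¹ ^ (1 : ℝ) :=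
          ENNReal.rpow_le_rpow_of_exponent_ge (by simp) ht.le
      _ = _ := by simp
  refine ⟨c⁻¹, ENNReal.inv_ne_top.2 hc0, fun v₀ v₁ h₀ h₁ u hu hB0 hBt => ?_⟩
  set w := apWeight v₀ v₁ t with hw
  have hwm : Measurable w := measurable_apWeight h₀.measurable h₁.measurable t
  set U : ℕ → ℝ → ℝ≥0∞ := fun k => (lineMax volume)^[k] u with hU
  have hUs : ∀ k, U (k + 1) = lineMax volume (U k) := fun k =>
    Function.iterate_succ_apply' _ _ _
  have hUm : ∀ k, Measurable (U k) := by
    intro k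
    cases k with
    | zero => exact hu
    | succ k => rw [hUs]; exact measurable_lineMax _ _
  set B := ∫⁻ s, u s ^ t * w s with hB
  have hUB : ∀ k, ∫⁻ s, U k s ^ t * w s ≤ expE x ^ k * B := by
    intro k
    induction k with
    | zero => simp [hU, hB]
    | succ k ih =>
      rw [hUs]
      calc _ ≤ C₀ * ∫⁻ s, U k s ^ t * w s := H₀ _ _ h₀ h₁ _ (hUm k)
        _ ≤ expE x * (expE x ^ k * B) := mul_le_mul' (by rw [← hx]; exact le_self_add) ih
        _ = _ := by ring
  set V : ℝ → ℝ≥0∞ := fun s => ∑' k, c ^ k * U k s with hV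
  have hVm : Measurable V := Measurable.tsum fun k => (hUm k).const_mul _
  have huV : ∀ s, u s ≤ V s := by
    intro s
    calc u s = c ^ 0 * U 0 s := by simp [hU]
      _ ≤ _ := ENNReal.le_tsum (f := fun k => c ^ k * U k s) 0
  have hMV : ∀ s, lineMax volume V s ≤ c⁻¹ * V s := by
    intro s
    calc lineMax volume V s ≤ ∑' k, c ^ k * U (k + 1) s := by
          simp_rw [hUs]
          exact lineMax_tsum_le _ hUm s
      _ = c⁻¹ * ∑' k, c ^ (k + 1) * U (k + 1) s := by
          rw [← ENNReal.tsum_mul_left]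
          refine tsum_congr fun k => ?_
          rw [pow_succ', mul_assoc c, ← mul_assoc c⁻¹, ENNReal.inv_mul_cancel hc0 hct, one_mul]
      _ ≤ _ := mul_le_mul_right (ENNReal.tsum_comp_le_tsum_of_injective
          (add_left_injective 1) (fun k => c ^ k * U k s)) _
  have hVB : ∫⁻ s, V s ^ t * w s ≤ 2 ^ t * 2 * B := by
    have hpt : ∀ s, V s ^ t ≤ 2 ^ t * ∑' k, ((2 * c) ^ k * U k s) ^ t := by
      intro s
      have e : V s = ∑' k : ℕ, (2⁻¹ : ℝ≥0∞) ^ k * ((2 * c) ^ k * U k s) := by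
        refine tsum_congr fun k => ?_
        rw [← mul_assoc, ← mul_pow, ← mul_assoc, ENNReal.inv_mul_cancel (by simp) (by simp),
          one_mul]
      rw [e]
      refine (tsum_mul_rpow_le ht0 _ _).trans_eq ?_
      rw [ENNReal.tsum_geometric, ENNReal.one_sub_inv_two, inv_inv]
    calc ∫⁻ s, V s ^ t * w s
        ≤ ∫⁻ s, 2 ^ t * ∑' k, ((2 * c) ^ k * U k s) ^ t * w s := by
          refine lintegral_mono fun s => ?_
          rw [ENNReal.tsum_mul_right, ← mul_assoc]
          exact mul_le_mul_left (hpt s) _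
      _ = 2 ^ t * ∑' k, ((2 * c) ^ t) ^ k * ∫⁻ s, U k s ^ t * w s := by
          have hm : ∀ k, Measurable fun s => ((2 * c) ^ k * U k s) ^ t * w s := fun k =>
            (((hUm k).const_mul _).pow_const _).mul hwm
          rw [lintegral_const_mul _ (Measurable.tsum hm),
            lintegral_tsum fun k => (hm k).aemeasurable]
          congr 1
          refine tsum_congr fun k => ?_
          rw [← lintegral_const_mul _ (measurable_rpow_mul (hUm k) hwm _)]
          refine lintegral_congr fun s => ?_
          rw [ENNReal.mul_rpow_of_nonneg _ _ ht0.le, mul_assoc]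
          congr 1
          rw [← ENNReal.rpow_natCast, ← ENNReal.rpow_natCast, ← ENNReal.rpow_mul,
            ← ENNReal.rpow_mul, mul_comm t]
      _ ≤ 2 ^ t * ∑' k : ℕ, 2⁻¹ ^ k * B := by
          refine mul_le_mul_right (ENNReal.tsum_le_tsum fun k => ?_) _
          calc _ ≤ ((2 * c) ^ t) ^ k * (expE x ^ k * B) := mul_le_mul_right (hUB k) _
            _ = ((2 * c) ^ t * expE x) ^ k * B := by rw [mul_pow, mul_assoc]
            _ ≤ _ := mul_le_mul_left (pow_le_pow_left' hcC k) _
      _ = _ := by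
          rw [ENNReal.tsum_mul_right, ENNReal.tsum_geometric, ENNReal.one_sub_inv_two, inv_inv,
            mul_assoc]
  have hu0 : ¬ u =ᵐ[volume] 0 := by
    intro h0
    apply hB0
    rw [hB, lintegral_eq_zero_iff (measurable_rpow_mul hu hwm _)]
    filter_upwards [h0] with s hs
    simp [hs, ht0]
  refine ⟨V, ⟨hVm, ae_of_all _ fun s => ?_, ?_, hMV⟩, huV, hVB⟩
  · intro h0
    have h1 := hMV s
    rw [h0, mul_zero, nonpos_iff_eq_zero] at h1
    refine lineMax_ne_zero hu hu0 s (le_antisymm ?_ zero_le)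
    exact (lineMax_mono _ huV s).trans_eq h1
  · have hfin : ∫⁻ s, V s ^ t * w s ≠ ∞ := ne_top_of_le_ne_top
      (ENNReal.mul_ne_top (ENNReal.mul_ne_top (two_rpow_ne_top _) (by simp)) hBt) hVB
    filter_upwards [ae_lt_top (measurable_rpow_mul hVm hwm _) hfin, apWeight_ae_expE h₀ h₁]
      with s hs ⟨a, b, _, _, hab⟩ htop
    simp only [hw, htop, hab, ENNReal.top_rpow_of_pos ht0, ENNReal.top_mul (expE_ne_zero _),
      lt_self_iff_false] at hs

lemma exists_extrapolation_down {r p : ℝ} (hp : 1 < p) (hpr : p < r) {K : ℝ≥0∞} (hK : K ≠ ∞) :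
    ∃ K' : ℝ≥0∞, K' ≠ ∞ ∧ ∀ C : ℝ≥0∞, C ≠ ∞ → ∃ C' : ℝ≥0∞, C' ≠ ∞ ∧ ∀ F G : ℝ → ℝ≥0∞,
      Measurable F → Measurable G →
      (∀ v₀ v₁, IsA1 K' v₀ → IsA1 K' v₁ →
        ∫⁻ s, F s ^ r * apWeight v₀ v₁ r s ≤ C * ∫⁻ s, G s ^ r * apWeight v₀ v₁ r s) →
      ∀ v₀ v₁, IsA1 K v₀ → IsA1 K v₁ →
        ∫⁻ s, F s ^ p * apWeight v₀ v₁ p s ≤ C' * ∫⁻ s, G s ^ p * apWeight v₀ v₁ p s := by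
  have hp0 : 0 < p := by linarith
  have hr0 : 0 < r := by linarith
  have hr1 : 0 < r - 1 := by linarith
  have hrp : 0 < r - p := by linarith
  set t := (r - 1) * p / (r - p) with ht
  have ht1 : 1 < t := by
    rw [ht, lt_div_iff₀ hrp]; nlinarith
  have ht0 : 0 < t := by linarith
  obtain ⟨K₁, hK₁, H₁⟩ := exists_isA1_majorant ht1 hK
  refine ⟨max K K₁, by simp [hK, hK₁], fun C hC => ?_⟩
  have hθ : 0 ≤ p / r := by positivity
  have hθ' : 0 ≤ 1 - p / r := by
    rw [sub_nonneg, div_le_one hr0]; exact hpr.le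
  refine ⟨C ^ (p / r) * (2 ^ t * 2) ^ (1 - p / r) + 1, ?_, fun F G hF hG H v₀ v₁ h₀ h₁ => ?_⟩
  · refine ENNReal.add_ne_top.2 ⟨ENNReal.mul_ne_top (ENNReal.rpow_ne_top_of_nonneg hθ hC)
      (ENNReal.rpow_ne_top_of_nonneg hθ' ?_), by simp⟩
    exact ENNReal.mul_ne_top (two_rpow_ne_top _) (by simp)
  have hwm := measurable_apWeight h₀.measurable h₁.measurable
  set B := ∫⁻ s, G s ^ p * apWeight v₀ v₁ p s with hB
  rcases eq_or_ne B ∞ with hBt | hBt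
  · rw [hBt, ENNReal.mul_top (by simp)]
    exact le_top
  rcases eq_or_ne B 0 with hB0 | hB0
  · rw [hB0, mul_zero, nonpos_iff_eq_zero]
    rw [hB, lintegral_eq_zero_iff (measurable_rpow_mul hG (hwm p) _)] at hB0
    have h1 : ∫⁻ s, G s ^ r * apWeight v₀ v₁ r s = 0 := by
      rw [lintegral_eq_zero_iff (measurable_rpow_mul hG (hwm r) _)]
      filter_upwards [hB0, apWeight_ae_expE h₀ h₁] with s hs ⟨a, b, _, _, hab⟩
      simp only [hab, Pi.zero_apply, mul_eq_zero, expE_ne_zero, or_false,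
        ENNReal.rpow_eq_zero_iff_of_pos hp0] at hs
      simp [hs, hr0]
    have h2 := H v₀ v₁ (h₀.mono (le_max_left _ _)) (h₁.mono (le_max_left _ _))
    rw [h1, mul_zero, nonpos_iff_eq_zero,
      lintegral_eq_zero_iff (measurable_rpow_mul hF (hwm r) _)] at h2
    rw [lintegral_eq_zero_iff (measurable_rpow_mul hF (hwm p) _)]
    filter_upwards [h2, apWeight_ae_expE h₀ h₁] with s hs ⟨a, b, _, _, hab⟩
    simp only [hab, Pi.zero_apply, mul_eq_zero, expE_ne_zero, or_false,
      ENNReal.rpow_eq_zero_iff_of_pos hr0] at hs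
    simp [hs, hp0]
  set u : ℝ → ℝ≥0∞ := fun s => (G s ^ (r - p) * v₁ s ^ (p - 1)) ^ (1 / (r - 1)) with hu
  have hum : Measurable u :=
    (measurable_rpow_mul hG (h₁.measurable.pow_const _) _).pow_const _
  have huB : ∫⁻ s, u s ^ t * apWeight v₀ v₁ t s = B := by
    refine lintegral_congr_ae ?_
    filter_upwards [h₀.ae_expE, h₁.ae_expE] with s ⟨a, ha⟩ ⟨b, hb⟩
    simp only [hu, apWeight, ha, hb]
    rw [← ENNReal.rpow_mul, ENNReal.mul_rpow_of_nonneg _ _ (by positivity), ← ENNReal.rpow_mul,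
      mul_assoc]
    have e : (r - p) * (1 / (r - 1) * t) = p := by
      rw [ht]; field_simp
    rw [e]
    congr 1
    simp only [expE_rpow, expE_mul]
    congr 1
    rw [ht]
    field_simp
    ring
  obtain ⟨V, hV, huV, hVB⟩ := H₁ v₀ v₁ h₀ h₁ u hum (by rwa [huB]) (by rwa [huB])
  rw [huB] at hVB
  have hVr := measurable_apWeight h₀.measurable hV.measurable r
  have hG1 : ∫⁻ s, G s ^ r * apWeight v₀ V r s ≤ B := by
    refine lintegral_mono_ae ?_
    filter_upwards [h₀.ae_expE, h₁.ae_expE, ae_lt_top (measurable_rpow_mul hG (hwm p) _) hBt]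
      with s ⟨a, ha⟩ ⟨b, hb⟩ hs
    simp only [apWeight, ha, hb] at hs ⊢
    have hGt : G s ≠ ∞ := by
      intro h
      rw [h, ENNReal.top_rpow_of_pos hp0, ENNReal.top_mul] at hs
      · exact absurd hs (lt_irrefl _)
      · rw [expE_rpow, expE_mul]; exact expE_ne_zero _
    rcases eq_or_ne (G s) 0 with hG0 | hG0
    · simp [hG0, hr0]
    obtain ⟨g, hg⟩ := exists_eq_expE hG0 hGt
    calc _ ≤ G s ^ r * (expE a * u s ^ (1 - r)) := mul_le_mul_right (mul_le_mul_right
          (rpow_le_rpow_of_exponent_nonpos (by linarith) (huV s)) _) _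
      _ = _ := by
        simp only [hu, hg, hb, expE_rpow, expE_mul]
        congr 1
        field_simp
        ring
  have hF1 := (H v₀ V (h₀.mono (le_max_left _ _)) (hV.mono (le_max_right _ _))).trans
    (mul_le_mul_right hG1 C)
  calc ∫⁻ s, F s ^ p * apWeight v₀ v₁ p s
      = ∫⁻ s, (F s ^ r * apWeight v₀ V r s) ^ (p / r) *
          (V s ^ t * apWeight v₀ v₁ t s) ^ (1 - p / r) := by
        refine lintegral_congr_ae ?_
        filter_upwards [h₀.ae_expE, h₁.ae_expE, hV.ae_expE] with s ⟨a, ha⟩ ⟨b, hb⟩ ⟨d, hd⟩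
        simp only [apWeight, ha, hb, hd]
        rw [ENNReal.mul_rpow_of_nonneg _ _ hθ, ← ENNReal.rpow_mul, mul_div_cancel₀ _ hr0.ne',
          mul_assoc]
        congr 1
        simp only [expE_rpow, expE_mul]
        congr 1
        rw [ht]
        field_simp
        ring
    _ ≤ (∫⁻ s, F s ^ r * apWeight v₀ V r s) ^ (p / r) *
          (∫⁻ s, V s ^ t * apWeight v₀ v₁ t s) ^ (1 - p / r) :=
        ENNReal.lintegral_mul_norm_pow_le (measurable_rpow_mul hF hVr _).aemeasurable
          (measurable_rpow_mul hV.measurable (hwm t) _).aemeasurable hθ hθ' (by ring)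
    _ ≤ (C * B) ^ (p / r) * (2 ^ t * 2 * B) ^ (1 - p / r) :=
        mul_le_mul' (ENNReal.rpow_le_rpow hF1 hθ) (ENNReal.rpow_le_rpow hVB hθ')
    _ = C ^ (p / r) * (2 ^ t * 2) ^ (1 - p / r) * B := by
        rw [ENNReal.mul_rpow_of_nonneg _ _ hθ, ENNReal.mul_rpow_of_nonneg _ _ hθ',
          mul_mul_mul_comm, ← ENNReal.rpow_add _ _ hB0 hBt, add_sub_cancel, ENNReal.rpow_one]
    _ ≤ _ := mul_le_mul_left le_self_add _

lemma exists_extrapolation_up {r p : ℝ} (hr : 1 < r) (hrp : r < p) {K : ℝ≥0∞} (hK : K ≠ ∞) :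
    ∃ K' : ℝ≥0∞, K' ≠ ∞ ∧ ∀ C : ℝ≥0∞, C ≠ ∞ → ∃ C' : ℝ≥0∞, C' ≠ ∞ ∧ ∀ F G : ℝ → ℝ≥0∞,
      Measurable F → Measurable G →
      (∀ v₀ v₁, IsA1 K' v₀ → IsA1 K' v₁ →
        ∫⁻ s, F s ^ r * apWeight v₀ v₁ r s ≤ C * ∫⁻ s, G s ^ r * apWeight v₀ v₁ r s) →
      ∀ v₀ v₁, IsA1 K v₀ → IsA1 K v₁ →
        ∫⁻ s, F s ^ p * apWeight v₀ v₁ p s ≤ C' * ∫⁻ s, G s ^ p * apWeight v₀ v₁ p s := by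
  have hp0 : 0 < p := by linarith
  have hr0 : 0 < r := by linarith
  have hpr : 0 < p - r := by linarith
  set t := p / (p - r) with ht
  have ht1 : 1 < t := by
    rw [ht, lt_div_iff₀ hpr]; linarith
  have ht0 : 0 < t := by linarith
  obtain ⟨K₁, hK₁, H₁⟩ := exists_isA1_majorant ht1 hK
  refine ⟨max K K₁, by simp [hK, hK₁], fun C hC => ?_⟩
  have hθ : 0 ≤ r / p := by positivity
  have hθ' : 0 ≤ 1 - r / p := by
    rw [sub_nonneg, div_le_one hp0]; exact hrp.le
  have hpr0 : 0 ≤ p / r := by positivity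
  set D : ℝ≥0∞ := C * (2 ^ t * 2) ^ (1 - r / p) with hD
  refine ⟨D ^ (p / r), ?_, fun F G hF hG H v₀ v₁ h₀ h₁ => ?_⟩
  · refine ENNReal.rpow_ne_top_of_nonneg hpr0 (ENNReal.mul_ne_top hC
      (ENNReal.rpow_ne_top_of_nonneg hθ' ?_))
    exact ENNReal.mul_ne_top (two_rpow_ne_top _) (by simp)
  have hwm := measurable_apWeight h₀.measurable h₁.measurable
  have hwm' := measurable_apWeight h₁.measurable h₀.measurable
  set B := ∫⁻ s, G s ^ p * apWeight v₀ v₁ p s with hB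
  refine le_of_forall_lt fun L hL => ?_
  obtain ⟨φ, hφF, hφt, hφL⟩ : ∃ φ : ℝ → ℝ≥0∞, (Measurable φ ∧
      ∀ s, φ s ≤ F s ^ p * apWeight v₀ v₁ p s) ∧ ∫⁻ s, φ s < ∞ ∧ L < ∫⁻ s, φ s := by
    rw [lintegral_eq_nnreal] at hL
    simp_rw [lt_iSup_iff] at hL
    obtain ⟨φ₀, hφ₀, hL⟩ := hL
    rw [← SimpleFunc.lintegral_eq_lintegral, SimpleFunc.coe_map] at hL
    obtain ⟨φ, h1, h2, h3⟩ := exists_lt_lintegral_simpleFunc_of_lt_lintegral (f := φ₀) hL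
    exact ⟨fun s => φ s, ⟨φ.measurable.coe_nnreal_ennreal,
      fun s => le_trans (ENNReal.coe_le_coe.2 (h1 s)) (hφ₀ s)⟩, h2, h3⟩
  obtain ⟨hφm, hφF⟩ := hφF
  set A := ∫⁻ s, φ s with hA
  have hA0 : A ≠ 0 := ((zero_le (a := L)).trans_lt hφL).ne'
  have hAt : A ≠ ∞ := hφt.ne
  refine hφL.trans_le ?_
  set F' : ℝ → ℝ≥0∞ := fun s => (φ s * (apWeight v₀ v₁ p s)⁻¹) ^ (1 / p) with hF'
  have hF'm : Measurable F' := (hφm.mul (hwm p).inv).pow_const _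
  have hF'p : ∀ s, F' s ^ p = φ s * (apWeight v₀ v₁ p s)⁻¹ := fun s => by
    rw [hF', ← ENNReal.rpow_mul, one_div_mul_cancel hp0.ne', ENNReal.rpow_one]
  have hF'A : ∫⁻ s, F' s ^ p * apWeight v₀ v₁ p s = A := by
    refine lintegral_congr_ae ?_
    filter_upwards [apWeight_ae_expE h₀ h₁] with s ⟨a, b, _, _, hab⟩
    simp only [hF'p, hab]
    rw [mul_assoc, ENNReal.inv_mul_cancel (expE_ne_zero _) (expE_ne_top _), mul_one]
  have hF'F : ∀ᵐ s, F' s ≤ F s := by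
    filter_upwards [apWeight_ae_expE h₀ h₁] with s ⟨a, b, _, _, hab⟩
    have h1 := hφF s
    rw [← ENNReal.rpow_le_rpow_iff hp0, hF'p]
    rw [hab] at h1 ⊢
    calc _ ≤ F s ^ p * expE (a + b * (1 - p)) * (expE (a + b * (1 - p)))⁻¹ :=
          mul_le_mul_left h1 _
      _ = _ := by rw [mul_assoc, ENNReal.mul_inv_cancel (expE_ne_zero _) (expE_ne_top _), mul_one]
  set u : ℝ → ℝ≥0∞ := fun s => F' s ^ (p - r) * (v₀ s * v₁ s ^ (r - p)) with hu
  have hum : Measurable u :=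
    (hF'm.pow_const _).mul (h₀.measurable.mul (h₁.measurable.pow_const _))
  have huA : ∫⁻ s, u s ^ t * apWeight v₁ v₀ t s = A := by
    rw [← hF'A]
    refine lintegral_congr_ae ?_
    filter_upwards [h₀.ae_expE, h₁.ae_expE] with s ⟨a, ha⟩ ⟨b, hb⟩
    simp only [hu, apWeight, ha, hb]
    rw [ENNReal.mul_rpow_of_nonneg _ _ ht0.le, ← ENNReal.rpow_mul, mul_assoc]
    have e : (p - r) * t = p := by
      rw [ht]; field_simp
    rw [e]
    congr 1
    simp only [expE_rpow, expE_mul]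
    congr 1
    rw [ht]
    field_simp
    ring
  obtain ⟨V, hV, huV, hVA⟩ := H₁ v₁ v₀ h₁ h₀ u hum (by rwa [huA]) (by rwa [huA])
  rw [huA] at hVA
  have hAle : A ≤ C * (B ^ (r / p) * (2 ^ t * 2 * A) ^ (1 - r / p)) := by
    calc A = ∫⁻ s, F' s ^ p * apWeight v₀ v₁ p s := hF'A.symm
      _ ≤ ∫⁻ s, F s ^ r * apWeight V v₁ r s := by
        refine lintegral_mono_ae ?_
        filter_upwards [h₀.ae_expE, h₁.ae_expE, hF'F] with s ⟨a, ha⟩ ⟨b, hb⟩ hs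
        calc F' s ^ p * apWeight v₀ v₁ p s = F' s ^ r * (u s * v₁ s ^ (1 - r)) := by
              have : F' s ^ p = F' s ^ r * F' s ^ (p - r) := by
                rw [← ENNReal.rpow_add_of_nonneg _ _ hr0.le hpr.le]
                ring_nf
              simp only [hu, apWeight, this, ha, hb]
              rw [mul_assoc, mul_assoc]
              congr 2
              simp only [expE_rpow, expE_mul]
              congr 1
              ring
          _ ≤ _ := mul_le_mul' (ENNReal.rpow_le_rpow hs hr0.le)
            (mul_le_mul_left (huV s) _)
      _ ≤ C * ∫⁻ s, G s ^ r * apWeight V v₁ r s :=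
        H V v₁ (hV.mono (le_max_right _ _)) (h₁.mono (le_max_left _ _))
      _ = C * ∫⁻ s, (G s ^ p * apWeight v₀ v₁ p s) ^ (r / p) *
          (V s ^ t * apWeight v₁ v₀ t s) ^ (1 - r / p) := by
        congr 1
        refine lintegral_congr_ae ?_
        filter_upwards [h₀.ae_expE, h₁.ae_expE, hV.ae_expE] with s ⟨a, ha⟩ ⟨b, hb⟩ ⟨d, hd⟩
        simp only [apWeight, ha, hb, hd]
        rw [ENNReal.mul_rpow_of_nonneg _ _ hθ, ← ENNReal.rpow_mul, mul_div_cancel₀ _ hp0.ne',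
          mul_assoc]
        congr 1
        simp only [expE_rpow, expE_mul]
        congr 1
        rw [ht]
        field_simp
        ring
      _ ≤ C * (B ^ (r / p) * (∫⁻ s, V s ^ t * apWeight v₁ v₀ t s) ^ (1 - r / p)) :=
        mul_le_mul_right (ENNReal.lintegral_mul_norm_pow_le
          (measurable_rpow_mul hG (hwm p) _).aemeasurable
          (measurable_rpow_mul hV.measurable (hwm' t) _).aemeasurable hθ hθ' (by ring)) _
      _ ≤ _ := mul_le_mul_right (mul_le_mul_right (ENNReal.rpow_le_rpow hVA hθ') _) _
  obtain ⟨x, hx⟩ := exists_eq_expE hA0 hAt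
  have h1 : A ^ (r / p) ≤ D * B ^ (r / p) := by
    calc A ^ (r / p) = A * A ^ (-(1 - r / p)) := by
          rw [hx, expE_rpow, expE_rpow, expE_mul]; congr 1; ring
      _ ≤ C * (B ^ (r / p) * (2 ^ t * 2 * A) ^ (1 - r / p)) * A ^ (-(1 - r / p)) :=
          mul_le_mul_left hAle _
      _ = D * B ^ (r / p) * (A ^ (1 - r / p) * A ^ (-(1 - r / p))) := by
          rw [ENNReal.mul_rpow_of_nonneg _ _ hθ', hD]
          ring
      _ = _ := by
          rw [hx, expE_rpow, expE_rpow, expE_mul, mul_neg, add_neg_cancel, expE_zero, mul_one]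
  calc A = (A ^ (r / p)) ^ (p / r) := by
        rw [← ENNReal.rpow_mul, div_mul_div_cancel₀' hr0.ne', div_self hp0.ne', ENNReal.rpow_one]
    _ ≤ (D * B ^ (r / p)) ^ (p / r) := ENNReal.rpow_le_rpow h1 hpr0
    _ = _ := by
        rw [ENNReal.mul_rpow_of_nonneg _ _ hpr0, ← ENNReal.rpow_mul,
          div_mul_div_cancel₀' hr0.ne', div_self hp0.ne', ENNReal.rpow_one]

/-- Extrapolation of weighted inequalities between any two exponents in `(1, ∞)`. -/
lemma exists_extrapolation {r p : ℝ} (hr : 1 < r) (hp : 1 < p) {K : ℝ≥0∞} (hK : K ≠ ∞) :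
    ∃ K' : ℝ≥0∞, K' ≠ ∞ ∧ ∀ C : ℝ≥0∞, C ≠ ∞ → ∃ C' : ℝ≥0∞, C' ≠ ∞ ∧ ∀ F G : ℝ → ℝ≥0∞,
      Measurable F → Measurable G →
      (∀ v₀ v₁, IsA1 K' v₀ → IsA1 K' v₁ →
        ∫⁻ s, F s ^ r * apWeight v₀ v₁ r s ≤ C * ∫⁻ s, G s ^ r * apWeight v₀ v₁ r s) →
      ∀ v₀ v₁, IsA1 K v₀ → IsA1 K v₁ →
        ∫⁻ s, F s ^ p * apWeight v₀ v₁ p s ≤ C' * ∫⁻ s, G s ^ p * apWeight v₀ v₁ p s := by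
  rcases lt_trichotomy p r with h | rfl | h
  · exact exists_extrapolation_down hp h hK
  · exact ⟨K, hK, fun C hC => ⟨C, hC, fun F G _ _ H => H⟩⟩
  · exact exists_extrapolation_up hr h hK

/-! ### Vector-valued bounds and the iterated maximal operator -/

lemma measurable_lineMax_uncurry {Z : Type} [MeasurableSpace Z] {h : Z → ℝ → ℝ≥0∞}
    (hh : Measurable (Function.uncurry h)) :
    Measurable fun z : Z × ℝ => lineMax volume (h z.1) z.2 := by
  refine Measurable.iSup fun r => ?_
  have h1 : Measurable fun z : Z => (volume (ratIoo r))⁻¹ * ∫⁻ y in ratIoo r, h z y :=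
    (Measurable.lintegral_prod_right' (ν := volume.restrict (ratIoo r)) hh).const_mul _
  exact (h1.comp measurable_fst).indicator (measurable_snd (measurableSet_ratIoo r))

/-- A functional on functions of a parameter for which the maximal operator on the line satisfies
weighted vector-valued inequalities. -/
structure IsLineMaxBounded {T : Type} [MeasurableSpace T] (N : (T → ℝ≥0∞) → ℝ≥0∞) : Prop where
  measurable : ∀ {Z : Type} [MeasurableSpace Z] {h : Z → T → ℝ≥0∞},
    Measurable (Function.uncurry h) → Measurable fun z => N (h z)
  lineMax_le : ∀ {q : ℝ}, 1 < q → ∀ {K : ℝ≥0∞}, K ≠ ∞ → ∃ C : ℝ≥0∞, C ≠ ∞ ∧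
    ∀ v₀ v₁, IsA1 K v₀ → IsA1 K v₁ → ∀ h : T → ℝ → ℝ≥0∞, Measurable (Function.uncurry h) →
      ∫⁻ s, N (fun t => lineMax volume (h t) s) ^ q * apWeight v₀ v₁ q s ≤
        C * ∫⁻ s, N (fun t => h t s) ^ q * apWeight v₀ v₁ q s

lemma isLineMaxBounded_unit : IsLineMaxBounded fun f : Unit → ℝ≥0∞ => f () where
  measurable hh := hh.comp (measurable_id.prodMk measurable_const)
  lineMax_le hq _ hK := by
    obtain ⟨C, hC, H⟩ := exists_weighted_lineMax hq hK
    exact ⟨C, hC, fun v₀ v₁ h₀ h₁ h hh =>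
      H v₀ v₁ h₀ h₁ (h ()) (hh.comp (measurable_const.prodMk measurable_id))⟩

/-- The functional obtained from `N` by taking an `L^q` norm in a further real variable. -/
def lpNext {T : Type} (N : (T → ℝ≥0∞) → ℝ≥0∞) (q : ℝ) (g : T × ℝ → ℝ≥0∞) : ℝ≥0∞ :=
  (∫⁻ s : ℝ, N (fun t => g (t, s)) ^ q) ^ (1 / q)

lemma lpNext_rpow {T : Type} (N : (T → ℝ≥0∞) → ℝ≥0∞) {q : ℝ} (hq : 0 < q) (g : T × ℝ → ℝ≥0∞) :
    lpNext N q g ^ q = ∫⁻ s : ℝ, N (fun t => g (t, s)) ^ q := by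
  rw [lpNext, ← ENNReal.rpow_mul, one_div_mul_cancel hq.ne', ENNReal.rpow_one]

lemma IsLineMaxBounded.lpNext {T : Type} [MeasurableSpace T] {N : (T → ℝ≥0∞) → ℝ≥0∞}
    (hN : IsLineMaxBounded N) {q : ℝ} (hq : 1 < q) : IsLineMaxBounded (lpNext N q) := by
  have hq0 : 0 < q := by linarith
  have hm : ∀ {Z : Type} [MeasurableSpace Z] {h : Z → T × ℝ → ℝ≥0∞},
      Measurable (Function.uncurry h) →
      Measurable fun z : Z × ℝ => N (fun t => h z.1 (t, z.2)) ^ q := fun {Z} _ {h} hh =>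
    (hN.measurable (Z := Z × ℝ) (h := fun z t => h z.1 (t, z.2)) 
      (hh.comp (g := Function.uncurry h) (f := fun z : (Z × ℝ) × T => (z.1.1, (z.2, z.1.2)))
        (by fun_prop))).pow_const _
  have hm' : ∀ {Z : Type} [MeasurableSpace Z] {h : Z → T × ℝ → ℝ≥0∞},
      Measurable (Function.uncurry h) → Measurable fun z => _root_.lpNext N q (h z) :=
    fun hh => (Measurable.lintegral_prod_right' (hm hh)).pow_const _
  refine ⟨hm', fun {p} hp {K} hK => ?_⟩
  obtain ⟨K', hK', H⟩ := exists_extrapolation hq hp hK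
  obtain ⟨C, hC, HC⟩ := hN.lineMax_le hq hK'
  obtain ⟨C', hC', H'⟩ := H C hC
  refine ⟨C', hC', fun v₀ v₁ h₀ h₁ h hh => ?_⟩
  have hsw : Measurable (Function.uncurry fun s : ℝ => fun t => h t s) := hh.comp measurable_swap
  have hMsw : Measurable (Function.uncurry fun s : ℝ => fun t => lineMax volume (h t) s) :=
    (measurable_lineMax_uncurry hh).comp measurable_swap
  refine H' _ _ (hm' hMsw) (hm' hsw) (fun w₀ w₁ k₀ k₁ => ?_) v₀ v₁ h₀ h₁
  have hw := measurable_apWeight k₀.measurable k₁.measurable q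
  have swap : ∀ {g : ℝ → T × ℝ → ℝ≥0∞}, Measurable (Function.uncurry g) →
      ∫⁻ s, _root_.lpNext N q (g s) ^ q * apWeight w₀ w₁ q s =
        ∫⁻ s', ∫⁻ s, N (fun t => g s (t, s')) ^ q * apWeight w₀ w₁ q s := by
    intro g hg
    rw [lintegral_lintegral_swap ((hm hg).comp measurable_swap |>.mul
      (hw.comp measurable_snd)).aemeasurable]
    refine lintegral_congr fun s => ?_
    rw [lpNext_rpow N hq0, ← lintegral_mul_const _
      (f := fun s' => N (fun t => g s (t, s')) ^ q) ((hm hg).comp measurable_prodMk_left)]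
  rw [swap hMsw, swap hsw, ← lintegral_const_mul' _ _ hC]
  exact lintegral_mono fun s' => HC w₀ w₁ k₀ k₁ (fun t => h (t, s'))
    (hh.comp (g := Function.uncurry h) (f := fun z : T × ℝ => ((z.1, s'), z.2)) (by fun_prop))

/-- The iterated maximal operator: the maximal operator on the line is applied in each variable
in turn. -/
def iterMax : (m : ℕ) → ((Fin m → ℝ) → ℝ≥0∞) → (Fin m → ℝ) → ℝ≥0∞
  | 0, f => f
  | m + 1, f => fun x =>
    lineMax volume (fun s => iterMax m (fun y => f (Fin.cons s y)) (Fin.tail x)) (x 0)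

lemma measurable_fin_cons {m : ℕ} :
    Measurable fun z : ℝ × (Fin m → ℝ) => (Fin.cons z.1 z.2 : Fin (m + 1) → ℝ) := by
  refine measurable_pi_lambda _ fun i => ?_
  refine Fin.cases ?_ (fun i => ?_) i
  · simpa using measurable_fst
  · exact (measurable_pi_apply i).comp measurable_snd

lemma measurable_fin_tail {m : ℕ} :
    Measurable fun x : Fin (m + 1) → ℝ => (Fin.tail x : Fin m → ℝ) :=
  measurable_pi_lambda _ fun i => measurable_pi_apply i.succ

lemma measurable_iterMax_uncurry {m : ℕ} {Z : Type} [MeasurableSpace Z]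
    {h : Z → (Fin m → ℝ) → ℝ≥0∞} (hh : Measurable (Function.uncurry h)) :
    Measurable fun z : Z × (Fin m → ℝ) => iterMax m (h z.1) z.2 := by
  induction m generalizing Z with
  | zero => exact hh
  | succ m ih =>
    have h1 : Measurable fun z : (Z × ℝ) × (Fin m → ℝ) =>
        iterMax m (fun y => h z.1.1 (Fin.cons z.1.2 y)) z.2 :=
      ih (h := fun z : Z × ℝ => fun y => h z.1 (Fin.cons z.2 y)) (hh.comp
        ((measurable_fst.comp measurable_fst).prodMk (measurable_fin_cons.comp
          ((measurable_snd.comp measurable_fst).prodMk measurable_snd))))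
    have h2 := measurable_lineMax_uncurry (Z := Z × (Fin m → ℝ))
      (h := fun z s => iterMax m (fun y => h z.1 (Fin.cons s y)) z.2)
      (h1.comp (g := fun z : (Z × ℝ) × (Fin m → ℝ) =>
          iterMax m (fun y => h z.1.1 (Fin.cons z.1.2 y)) z.2)
        (f := fun z : (Z × (Fin m → ℝ)) × ℝ => ((z.1.1, z.2), z.1.2)) (by fun_prop))
    exact h2.comp ((measurable_fst.prodMk (measurable_fin_tail.comp measurable_snd)).prodMk
      ((measurable_pi_apply 0).comp measurable_snd))

lemma mixedNormAux_mono {m : ℕ} {q : Fin m → ℝ} (hq : ∀ i, 0 < q i)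
    {f g : (Fin m → ℝ) → ℝ≥0∞} (h : ∀ x, f x ≤ g x) :
    mixedNormAux m q f ≤ mixedNormAux m q g := by
  induction m with
  | zero => exact h _
  | succ m ih =>
    refine ih (fun i => hq i.succ) fun x => ENNReal.rpow_le_rpow (lintegral_mono fun s =>
      ENNReal.rpow_le_rpow (h _) (hq 0).le) (one_div_nonneg.2 (hq 0).le)

lemma mixedNormAux_const_mul {m : ℕ} {q : Fin m → ℝ} (hq : ∀ i, 0 < q i) {c : ℝ≥0∞}
    (hc : c ≠ ∞) (f : (Fin m → ℝ) → ℝ≥0∞) :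
    mixedNormAux m q (fun x => c * f x) = c * mixedNormAux m q f := by
  induction m with
  | zero => rfl
  | succ m ih =>
    rw [mixedNormAux, mixedNormAux, ← ih fun i => hq i.succ]
    congr 1
    ext x
    have h0 := (hq 0).le
    simp_rw [ENNReal.mul_rpow_of_nonneg _ _ h0]
    rw [lintegral_const_mul' _ _ (ENNReal.rpow_ne_top_of_nonneg h0 hc),
      ENNReal.mul_rpow_of_nonneg _ _ (one_div_nonneg.2 h0), ← ENNReal.rpow_mul,
      mul_one_div_cancel (hq 0).ne', ENNReal.rpow_one]

lemma exists_iterMax_le {m : ℕ} {q : Fin m → ℝ} (hq : ∀ i, 1 < q i) {T : Type}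
    [MeasurableSpace T] {N : (T → ℝ≥0∞) → ℝ≥0∞} (hN : IsLineMaxBounded N) :
    ∃ C : ℝ≥0∞, C ≠ ∞ ∧ ∀ h : T → (Fin m → ℝ) → ℝ≥0∞, Measurable (Function.uncurry h) →
      mixedNormAux m q (fun x => N fun t => iterMax m (h t) x) ≤
        C * mixedNormAux m q (fun x => N fun t => h t x) := by
  induction m generalizing T with
  | zero => exact ⟨1, by simp, fun h _ => by simp [iterMax]⟩
  | succ m ih =>
    have h0 : 0 < q 0 := by linarith [hq 0]
    obtain ⟨C₁, hC₁, H₁⟩ := hN.lineMax_le (hq 0) ENNReal.one_ne_top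
    obtain ⟨C₂, hC₂, H₂⟩ := ih (fun i => hq i.succ) (hN.lpNext (hq 0))
    have hC : C₁ ^ (1 / q 0) ≠ ∞ := ENNReal.rpow_ne_top_of_nonneg (by positivity) hC₁
    refine ⟨C₁ ^ (1 / q 0) * C₂, ENNReal.mul_ne_top hC hC₂, fun h hh => ?_⟩
    have hh' : Measurable (Function.uncurry fun (z : T × ℝ) (y : Fin m → ℝ) =>
        h z.1 (Fin.cons z.2 y)) := hh.comp
      ((measurable_fst.comp measurable_fst).prodMk (measurable_fin_cons.comp
          ((measurable_snd.comp measurable_fst).prodMk measurable_snd)))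
    have hM := measurable_iterMax_uncurry hh'
    have key : ∀ x : Fin m → ℝ,
        (∫⁻ s, (N fun t => iterMax (m + 1) (h t) (Fin.cons s x)) ^ q 0) ^ (1 / q 0) ≤
          C₁ ^ (1 / q 0) * lpNext N (q 0)
            (fun z => iterMax m (fun y => h z.1 (Fin.cons z.2 y)) x) := by
      intro x
      rw [lpNext, ← ENNReal.mul_rpow_of_nonneg _ _ (by positivity)]
      refine ENNReal.rpow_le_rpow ?_ (by positivity)
      have := H₁ _ _ isA1_one isA1_one
        (fun t s => iterMax m (fun y => h t (Fin.cons s y)) x)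
        (hM.comp (measurable_id.prodMk measurable_const))
      simpa [apWeight, iterMax] using this
    calc _ ≤ _ := mixedNormAux_mono (fun i => by linarith [hq i.succ]) key
      _ = _ := mixedNormAux_const_mul (fun i => by linarith [hq i.succ]) hC _
      _ ≤ C₁ ^ (1 / q 0) * _ := mul_le_mul_right (H₂ _ hh') _
      _ = _ := by rw [← mul_assoc]; rfl

/-! ### Domination of the Hardy–Littlewood maximal operator -/

lemma setLIntegral_Ioo_le_lineMax (f : ℝ → ℝ≥0∞) {a b s : ℝ} (hs : s ∈ Ioo a b) :
    ∫⁻ y in Ioo a b, f y ≤ ENNReal.ofReal (2 * (b - a)) * lineMax volume f s := by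
  have hab : a < b := hs.1.trans hs.2
  obtain ⟨a', h1, h2⟩ := exists_rat_btwn (show a - (b - a) / 2 < a by linarith)
  obtain ⟨b', h3, h4⟩ := exists_rat_btwn (show b < b + (b - a) / 2 by linarith)
  have hsub : Ioo a b ⊆ ratIoo (a', b') := Ioo_subset_Ioo h2.le h3.le
  have hv0 := volume_ratIoo_ne_zero (hsub hs)
  have hvt := volume_ratIoo_ne_top (a', b')
  calc ∫⁻ y in Ioo a b, f y ≤ ∫⁻ y in ratIoo (a', b'), f y := lintegral_mono_set hsub
    _ = volume (ratIoo (a', b')) * ((volume (ratIoo (a', b')))⁻¹ *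
          ∫⁻ y in ratIoo (a', b'), f y) := by
        rw [← mul_assoc, ENNReal.mul_inv_cancel hv0 hvt, one_mul]
    _ ≤ _ := by
        refine mul_le_mul' ?_ (average_le_lineMax volume f (hsub hs))
        rw [ratIoo, Real.volume_Ioo]
        exact ENNReal.ofReal_le_ofReal (by dsimp only; linarith)

lemma lintegral_fin_cons {m : ℕ} {f : (Fin (m + 1) → ℝ) → ℝ≥0∞} (hf : Measurable f) :
    ∫⁻ x, f x = ∫⁻ s : ℝ, ∫⁻ y : Fin m → ℝ, f (Fin.cons s y) := by
  have e := (volume_preserving_piFinSuccAbove (fun _ : Fin (m + 1) => ℝ) 0).symm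
  rw [← e.lintegral_comp_emb (MeasurableEquiv.measurableEmbedding _) f, Measure.volume_eq_prod,
    lintegral_prod (fun z => f ((MeasurableEquiv.piFinSuccAbove (fun _ => ℝ) 0).symm z))
      (hf.comp (MeasurableEquiv.measurable _)).aemeasurable]
  refine lintegral_congr fun s => lintegral_congr fun y => ?_
  congr 1
  simp [MeasurableEquiv.piFinSuccAbove, Fin.consEquiv]

lemma setLIntegral_pi_Ioo_le_iterMax {m : ℕ} {f : (Fin m → ℝ) → ℝ≥0∞} (hf : Measurable f)
    {c : Fin m → ℝ} {r : ℝ} {x : Fin m → ℝ} (hx : ∀ i, x i ∈ Ioo (c i - r) (c i + r)) :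
    ∫⁻ y in {y | ∀ i, y i ∈ Ioo (c i - r) (c i + r)}, f y ≤
      ENNReal.ofReal (4 * r) ^ m * iterMax m f x := by
  induction m with
  | zero =>
    have : volume (univ : Set (Fin 0 → ℝ)) = 1 := by simp [volume_pi]
    rw [pow_zero, one_mul, iterMax]
    calc _ ≤ ∫⁻ y, f y := setLIntegral_le_lintegral _ _
      _ = ∫⁻ y : Fin 0 → ℝ, f x := lintegral_congr fun y => by rw [Subsingleton.elim y x]
      _ ≤ _ := by simp [this]
  | succ m ih =>
    have hm : ∀ {k : ℕ} (c : Fin k → ℝ),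
        MeasurableSet {y : Fin k → ℝ | ∀ i, y i ∈ Ioo (c i - r) (c i + r)} := by
      intro k c
      simp only [ofPred_forall]
      exact MeasurableSet.iInter fun i => measurable_pi_apply i measurableSet_Ioo
    have hfc : ∀ s, Measurable fun y : Fin m → ℝ => f (Fin.cons s y) := fun s =>
      hf.comp (measurable_fin_cons.comp measurable_prodMk_left)
    rw [← lintegral_indicator (hm c), lintegral_fin_cons (hf.indicator (hm c))]
    have hpt : ∀ s, ∫⁻ y : Fin m → ℝ, ({y | ∀ i, y i ∈ Ioo (c i - r) (c i + r)}.indicator f)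
        (Fin.cons s y) ≤ (Ioo (c 0 - r) (c 0 + r)).indicator (fun s =>
          ENNReal.ofReal (4 * r) ^ m * iterMax m (fun y => f (Fin.cons s y)) (Fin.tail x)) s := by
      intro s
      by_cases hs : s ∈ Ioo (c 0 - r) (c 0 + r)
      · rw [indicator_of_mem hs]
        refine le_trans (le_of_eq ?_) (ih (c := Fin.tail c) (x := Fin.tail x) (hfc s)
          fun i => hx i.succ)
        rw [← lintegral_indicator (hm _)]
        refine lintegral_congr fun y => ?_
        simp only [indicator, mem_ofPred_eq]
        congr 1
        simp only [Fin.forall_fin_succ, Fin.cons_zero, Fin.cons_succ, hs, true_and, Fin.tail]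
      · rw [indicator_of_notMem hs]
        refine le_of_eq ?_
        refine (lintegral_congr fun y => indicator_of_notMem (fun h => hs ?_) _).trans
          lintegral_zero
        simpa using h 0
    refine (lintegral_mono hpt).trans ?_
    rw [lintegral_indicator measurableSet_Ioo, lintegral_const_mul' _ _ (by finiteness), pow_succ,
      mul_assoc]
    refine mul_le_mul_right ((setLIntegral_Ioo_le_lineMax _ (hx 0)).trans_eq ?_) _
    rw [iterMax]
    congr 2
    ring

lemma setLIntegral_ball_le_iterMax {n : ℕ} {f : Euc n → ℝ≥0∞} (hf : Measurable f) {c x : Euc n}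
    {r : ℝ} (hx : x ∈ Metric.ball c r) :
    ∫⁻ y in Metric.ball c r, f y ≤ ENNReal.ofReal (4 * r) ^ n *
      iterMax n (fun y => f ((EuclideanSpace.equiv (Fin n) ℝ).symm y))
        (EuclideanSpace.equiv (Fin n) ℝ x) := by
  have hcoord : ∀ y ∈ Metric.ball c r, ∀ i, y i ∈ Ioo (c i - r) (c i + r) := by
    intro y hy i
    have h1 := (PiLp.norm_apply_le (y - c) i).trans_lt (mem_ball_iff_norm.1 hy)
    rw [PiLp.sub_apply, Real.norm_eq_abs, abs_lt] at h1
    exact ⟨by linarith, by linarith⟩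
  have e := PiLp.volume_preserving_toLp (Fin n)
  have hmeas : Measurable fun y : Fin n → ℝ => f ((EuclideanSpace.equiv (Fin n) ℝ).symm y) :=
    hf.comp (EuclideanSpace.equiv (Fin n) ℝ).symm.continuous.measurable
  refine le_trans ?_ (setLIntegral_pi_Ioo_le_iterMax hmeas (c := c) (hcoord x hx))
  rw [← e.setLIntegral_comp_preimage measurableSet_ball hf]
  exact lintegral_mono_set fun y hy => hcoord _ hy

lemma exists_maximalFn_le_iterMax (n : ℕ) : ∃ C : ℝ≥0∞, C ≠ ∞ ∧ ∀ f : Euc n → ℝ≥0∞,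
    Measurable f → ∀ x, maximalFn f x ≤ C *
      iterMax n (fun y => f ((EuclideanSpace.equiv (Fin n) ℝ).symm y))
        (EuclideanSpace.equiv (Fin n) ℝ x) := by
  have hv0 : volume (Metric.ball (0 : Euc n) 1) ≠ 0 := (Metric.measure_ball_pos _ _ one_pos).ne'
  have hvt : volume (Metric.ball (0 : Euc n) 1) ≠ ∞ := measure_ball_lt_top.ne
  refine ⟨(volume (Metric.ball (0 : Euc n) 1))⁻¹ * 4 ^ n,
    ENNReal.mul_ne_top (ENNReal.inv_ne_top.2 hv0) (by finiteness), fun f hf x => ?_⟩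
  refine iSup_le fun c => iSup_le fun r => iSup_le fun hr => iSup_le fun hx => ?_
  refine (mul_le_mul_right (setLIntegral_ball_le_iterMax hf hx) _).trans_eq ?_
  rw [← mul_assoc]
  congr 1
  have hr0 : ENNReal.ofReal (r ^ n) ≠ 0 := by
    rw [ne_eq, ENNReal.ofReal_eq_zero, not_le]; positivity
  rw [Measure.addHaar_ball_of_pos _ _ hr, finrank_euclideanSpace, Fintype.card_fin,
    ENNReal.mul_inv (Or.inl hr0) (Or.inl ENNReal.ofReal_ne_top),
    ENNReal.ofReal_mul (by norm_num), mul_pow, ← ENNReal.ofReal_pow hr.le,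
    show ENNReal.ofReal 4 = 4 by norm_num]
  calc _ = (ENNReal.ofReal (r ^ n))⁻¹ * ENNReal.ofReal (r ^ n) *
        ((volume (Metric.ball (0 : Euc n) 1))⁻¹ * 4 ^ n) := by ring
    _ = _ := by rw [ENNReal.inv_mul_cancel hr0 ENNReal.ofReal_ne_top, one_mul]

lemma mixedNorm_mono {n : ℕ} {q : Fin n → ℝ} (hq : ∀ i, 0 < q i) {f g : Euc n → ℝ≥0∞}
    (h : ∀ x, f x ≤ g x) : mixedNorm q f ≤ mixedNorm q g :=
  mixedNormAux_mono hq fun _ => h _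

lemma mixedNorm_const_mul {n : ℕ} {q : Fin n → ℝ} (hq : ∀ i, 0 < q i) {c : ℝ≥0∞} (hc : c ≠ ∞)
    (f : Euc n → ℝ≥0∞) : mixedNorm q (fun x => c * f x) = c * mixedNorm q f :=
  mixedNormAux_const_mul hq hc _

theorem exists_mixedNorm_maximalFn_le {n : ℕ} {q : Fin n → ℝ} (hq : ∀ i, 1 < q i) :
    ∃ C : ℝ≥0∞, C ≠ ∞ ∧ ∀ f : Euc n → ℝ≥0∞, Measurable f →
      mixedNorm q (maximalFn f) ≤ C * mixedNorm q f := by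
  have hq0 : ∀ i, 0 < q i := fun i => by linarith [hq i]
  obtain ⟨C₁, hC₁, H₁⟩ := exists_maximalFn_le_iterMax n
  obtain ⟨C₂, hC₂, H₂⟩ := exists_iterMax_le hq isLineMaxBounded_unit
  refine ⟨C₁ * C₂, ENNReal.mul_ne_top hC₁ hC₂, fun f hf => ?_⟩
  have hmeas : Measurable fun y : Fin n → ℝ => f ((EuclideanSpace.equiv (Fin n) ℝ).symm y) :=
    hf.comp (EuclideanSpace.equiv (Fin n) ℝ).symm.continuous.measurable
  calc _ ≤ _ := mixedNorm_mono hq0 (H₁ f hf)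
    _ = _ := mixedNorm_const_mul hq0 hC₁ _
    _ ≤ C₁ * _ := mul_le_mul_right (H₂ (fun _ => fun y =>
        f ((EuclideanSpace.equiv (Fin n) ℝ).symm y)) (hmeas.comp measurable_snd)) _
    _ = _ := by rw [← mul_assoc]; rfl

/-! ### Mixed norms of sums and of indicators -/

lemma mixedNormAux_add_le {m : ℕ} {q : Fin m → ℝ} (hq : ∀ i, 1 ≤ q i)
    {f g : (Fin m → ℝ) → ℝ≥0∞} (hf : Measurable f) (hg : Measurable g) :
    mixedNormAux m q (fun x => f x + g x) ≤ mixedNormAux m q f + mixedNormAux m q g := by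
  induction m with
  | zero => exact le_rfl
  | succ m ih =>
    have hm : ∀ {k : (Fin (m + 1) → ℝ) → ℝ≥0∞}, Measurable k →
        Measurable fun x : Fin m → ℝ => (∫⁻ s, k (Fin.cons s x) ^ q 0) ^ (1 / q 0) := fun hk =>
      (Measurable.lintegral_prod_left' (f := fun z : ℝ × (Fin m → ℝ) => _ ^ q 0)
        ((hk.comp measurable_fin_cons).pow_const _)).pow_const _
    refine le_trans ?_ (ih (fun i => hq i.succ) (hm hf) (hm hg))
    refine mixedNormAux_mono (fun i => by linarith [hq i.succ]) fun x => ?_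
    have hc : Measurable fun s : ℝ => (Fin.cons s x : Fin (m + 1) → ℝ) :=
      measurable_fin_cons.comp measurable_prodMk_right
    exact ENNReal.lintegral_Lp_add_le (hf.comp hc).aemeasurable (hg.comp hc).aemeasurable (hq 0)

lemma indicator_one_le_indicator_one {X Y : Type} {A : Set X} {B : Set Y} {x : X} {y : Y}
    (h : x ∈ A → y ∈ B) : A.indicator (1 : X → ℝ≥0∞) x ≤ B.indicator 1 y := by
  by_cases hx : x ∈ A
  · simp [hx, h hx]
  · simp [hx]

lemma mixedNormAux_indicator_cube {m : ℕ} {q : Fin m → ℝ} (hq : ∀ i, 0 < q i) {r : ℝ}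
    (hr : 0 < r) :
    mixedNormAux m q ((univ.pi fun _ => Ioo (-r) r).indicator 1) =
      ENNReal.ofReal (2 * r) ^ ∑ i, 1 / q i := by
  induction m with
  | zero => simp [mixedNormAux]
  | succ m ih =>
    have h0 := hq 0
    have hr0 : ENNReal.ofReal (2 * r) ≠ 0 := by
      rw [ne_eq, ENNReal.ofReal_eq_zero, not_le]; positivity
    have key : ∀ x : Fin m → ℝ, (∫⁻ s, ((univ.pi fun _ => Ioo (-r) r).indicator 1)
        (Fin.cons s x : Fin (m + 1) → ℝ) ^ q 0) ^ (1 / q 0) =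
          ENNReal.ofReal (2 * r) ^ (1 / q 0) * ((univ.pi fun _ => Ioo (-r) r).indicator 1) x := by
      intro x
      by_cases hx : ∀ i, x i ∈ Ioo (-r) r
      · have : ∀ s, ((univ.pi fun _ => Ioo (-r) r).indicator (1 : (Fin (m + 1) → ℝ) → ℝ≥0∞))
            (Fin.cons s x) ^ q 0 = (Ioo (-r) r).indicator 1 s := by
          intro s
          have e : (∀ i, (Fin.cons s x : Fin (m + 1) → ℝ) i ∈ Ioo (-r) r) ↔ s ∈ Ioo (-r) r := by
            simp only [Fin.forall_fin_succ, Fin.cons_zero, Fin.cons_succ, hx, implies_true,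
              and_true]
          by_cases hs : s ∈ Ioo (-r) r
          · rw [indicator_of_mem (mem_univ_pi.2 (e.2 hs)), indicator_of_mem hs]
            simp
          · rw [indicator_of_notMem fun h => hs (e.1 (mem_univ_pi.1 h)), indicator_of_notMem hs,
              ENNReal.zero_rpow_of_pos h0]
        rw [lintegral_congr this, lintegral_indicator_one measurableSet_Ioo, Real.volume_Ioo,
          indicator_of_mem (mem_univ_pi.2 hx), Pi.one_apply, mul_one, sub_neg_eq_add, two_mul]
      · have : ∀ s, ((univ.pi fun _ => Ioo (-r) r).indicator (1 : (Fin (m + 1) → ℝ) → ℝ≥0∞))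
            (Fin.cons s x) ^ q 0 = 0 := by
          intro s
          rw [indicator_of_notMem fun h => hx fun i => by simpa using mem_univ_pi.1 h i.succ,
            ENNReal.zero_rpow_of_pos h0]
        rw [lintegral_congr this, indicator_of_notMem fun h => hx (mem_univ_pi.1 h), lintegral_zero,
          mul_zero,
          ENNReal.zero_rpow_of_pos (one_div_pos.2 h0)]
    rw [mixedNormAux]
    simp_rw [key]
    rw [mixedNormAux_const_mul (fun i => hq i.succ)
      (ENNReal.rpow_ne_top_of_nonneg (one_div_nonneg.2 h0.le) ENNReal.ofReal_ne_top),
      ih fun i => hq i.succ, Fin.sum_univ_succ, ENNReal.rpow_add _ _ hr0 ENNReal.ofReal_ne_top]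

section MixedNorm

variable {n : ℕ} {q : Fin n → ℝ}

lemma mixedNorm_add_le (hq : ∀ i, 1 ≤ q i) {f g : Euc n → ℝ≥0∞} (hf : Measurable f)
    (hg : Measurable g) : mixedNorm q (fun x => f x + g x) ≤ mixedNorm q f + mixedNorm q g :=
  mixedNormAux_add_le hq (hf.comp (EuclideanSpace.equiv (Fin n) ℝ).symm.continuous.measurable)
    (hg.comp (EuclideanSpace.equiv (Fin n) ℝ).symm.continuous.measurable)

lemma mixedNorm_finset_sum_le (hq : ∀ i, 1 ≤ q i) {ι : Type} (s : Finset ι)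
    {f : ι → Euc n → ℝ≥0∞} (hf : ∀ j, Measurable (f j)) :
    mixedNorm q (fun x => ∑ j ∈ s, f j x) ≤ ∑ j ∈ s, mixedNorm q (f j) := by
  classical
  induction s using Finset.induction_on with
  | empty =>
    have := mixedNorm_const_mul (q := q) (fun i => by linarith [hq i]) ENNReal.zero_ne_top 1
    simpa using this.le
  | insert j s hj ih =>
    simp_rw [Finset.sum_insert hj]
    exact (mixedNorm_add_le hq (hf j) (Finset.measurable_sum s fun j _ => hf j)).trans
      (add_le_add_right ih _)

lemma mixedNorm_indicator_ball_le (hq : ∀ i, 0 < q i) {r : ℝ} (hr : 0 < r) :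
    mixedNorm q ((Metric.ball 0 r).indicator 1) ≤ ENNReal.ofReal (2 * r) ^ ∑ i, 1 / q i := by
  rw [← mixedNormAux_indicator_cube hq hr]
  refine mixedNormAux_mono hq fun x => ?_
  refine indicator_one_le_indicator_one fun h => mem_univ_pi.2 fun i => ?_
  have h1 := (PiLp.norm_apply_le ((EuclideanSpace.equiv (Fin n) ℝ).symm x) i).trans_lt
    (mem_ball_zero_iff.1 h)
  exact abs_lt.1 h1

lemma le_mixedNorm_indicator_ball (hq : ∀ i, 0 < q i) {r : ℝ} (hr : 0 < r) :
    ENNReal.ofReal (2 * (r / (n + 1))) ^ ∑ i, 1 / q i ≤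
      mixedNorm q ((Metric.ball 0 r).indicator 1) := by
  have hr' : 0 < r / (n + 1) := by positivity
  rw [← mixedNormAux_indicator_cube hq hr']
  refine mixedNormAux_mono hq fun x => ?_
  refine indicator_one_le_indicator_one fun h => mem_ball_zero_iff.2 ?_
  have h1 : ∀ i, |x i| ≤ r / (n + 1) := fun i => (abs_lt.2 (mem_univ_pi.1 h i)).le
  rw [EuclideanSpace.norm_eq, Real.sqrt_lt' hr]
  calc ∑ i, ‖x i‖ ^ 2 ≤ ∑ i : Fin n, (r / (n + 1)) ^ 2 := Finset.sum_le_sum fun i _ =>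
        pow_le_pow_left₀ (norm_nonneg _) (h1 i) 2
    _ = n * (r / (n + 1)) ^ 2 := by simp
    _ < r ^ 2 := by
      rw [div_pow, ← mul_div_assoc, div_lt_iff₀ (by positivity)]
      have : (0 : ℝ) ≤ n := n.cast_nonneg
      have h2 : (n : ℝ) < (n + 1) ^ 2 := by nlinarith
      nlinarith [mul_pos (pow_pos hr 2) (sub_pos.2 h2)]

end MixedNorm

/-! ### The maximal function on dyadic annuli -/

lemma ofReal_two_zpow (k : ℤ) : ENNReal.ofReal ((2 : ℝ) ^ k) = (2 : ℝ≥0∞) ^ (k : ℝ) := by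
  rw [← Real.rpow_intCast, ← ENNReal.ofReal_rpow_of_pos two_pos]
  norm_num

lemma measurable_maximalFn {n : ℕ} (f : Euc n → ℝ≥0∞) : Measurable (maximalFn f) := by
  refine measurable_of_Ioi fun a => IsOpen.measurableSet ?_
  have : maximalFn f ⁻¹' Ioi a = ⋃ (c : Euc n) (r : ℝ) (_ : 0 < r)
      (_ : a < (volume (Metric.ball c r))⁻¹ * ∫⁻ y in Metric.ball c r, f y), Metric.ball c r := by
    ext x
    simp only [maximalFn, mem_preimage, mem_Ioi, lt_iSup_iff, mem_iUnion, exists_prop]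
    tauto
  rw [this]
  exact isOpen_iUnion fun c => isOpen_iUnion fun r => isOpen_iUnion fun _ =>
    isOpen_iUnion fun _ => Metric.isOpen_ball

lemma average_le_maximalFn {n : ℕ} (f : Euc n → ℝ≥0∞) {c x : Euc n} {r : ℝ} (hr : 0 < r)
    (hx : x ∈ Metric.ball c r) :
    (volume (Metric.ball c r))⁻¹ * ∫⁻ y in Metric.ball c r, f y ≤ maximalFn f x :=
  le_iSup_of_le c (le_iSup_of_le r (le_iSup_of_le hr (le_iSup_of_le hx le_rfl)))

lemma mem_annulus {n : ℕ} {k : ℤ} {x : Euc n} :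
    x ∈ annulus n k ↔ ‖x‖ < 2 ^ k ∧ 2 ^ (k - 1) ≤ ‖x‖ := by
  simp [annulus]

lemma measurableSet_annulus (n : ℕ) (k : ℤ) : MeasurableSet (annulus n k) :=
  measurableSet_ball.diff measurableSet_ball

lemma le_tsum_indicator_annulus {n : ℕ} (f : Euc n → ℝ≥0∞) {x : Euc n} (hx : x ≠ 0) :
    f x ≤ ∑' j, (annulus n j).indicator f x := by
  obtain ⟨j, h1, h2⟩ := exists_mem_Ico_zpow (norm_pos_iff.2 hx) one_lt_two
  have hj : x ∈ annulus n (j + 1) := mem_annulus.2 ⟨h2, by simpa using h1⟩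
  calc f x = (annulus n (j + 1)).indicator f x := (indicator_of_mem hj _).symm
    _ ≤ _ := ENNReal.le_tsum (f := fun j => (annulus n j).indicator f x) (j + 1)

lemma setLIntegral_le_tsum_annulus {n : ℕ} (hn : 2 ≤ n) {f : Euc n → ℝ≥0∞} (hf : Measurable f)
    (s : Set (Euc n)) :
    ∫⁻ y in s, f y ≤ ∑' j, ∫⁻ y in s, (annulus n j).indicator f y := by
  have : Nontrivial (Euc n) := Module.nontrivial_of_finrank_pos (R := ℝ) (by simp; omega)
  rw [← lintegral_tsum fun j => (hf.indicator (measurableSet_annulus n j)).aemeasurable]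
  refine lintegral_mono_ae (ae_restrict_of_ae ?_)
  filter_upwards [compl_mem_ae_iff.2 (measure_singleton (0 : Euc n))] with x hx
  exact le_tsum_indicator_annulus f hx

lemma maximalFn_le_tsum_annulus {n : ℕ} (hn : 2 ≤ n) {f : Euc n → ℝ≥0∞} (hf : Measurable f)
    (x : Euc n) : maximalFn f x ≤ ∑' j, maximalFn ((annulus n j).indicator f) x := by
  refine iSup_le fun c => iSup_le fun r => iSup_le fun hr => iSup_le fun hx => ?_
  refine (mul_le_mul_right (setLIntegral_le_tsum_annulus hn hf _) _).trans ?_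
  rw [← ENNReal.tsum_mul_left]
  exact ENNReal.tsum_le_tsum fun j => average_le_maximalFn _ hr hx

lemma volume_ball_zpow {n : ℕ} (c : Euc n) (k : ℤ) :
    volume (Metric.ball c ((2 : ℝ) ^ k)) =
      (2 : ℝ≥0∞) ^ ((k : ℝ) * n) * volume (Metric.ball (0 : Euc n) 1) := by
  rw [Measure.addHaar_ball_of_pos _ _ (by positivity), finrank_euclideanSpace, Fintype.card_fin,
    ENNReal.ofReal_pow (by positivity), ofReal_two_zpow, ENNReal.rpow_mul, ENNReal.rpow_natCast]

lemma maximalFn_annulus_le {n : ℕ} {f : Euc n → ℝ≥0∞} {j k : ℤ} (hjk : 2 ≤ |j - k|) {x : Euc n}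
    (hx : x ∈ annulus n k) :
    maximalFn ((annulus n j).indicator f) x ≤
      8 ^ n * (volume (Metric.ball (0 : Euc n) 1))⁻¹ * (2 : ℝ≥0∞) ^ (-(max (j : ℝ) k * n)) *
        ∫⁻ y in Metric.ball 0 (2 ^ j), (annulus n j).indicator f y := by
  refine iSup_le fun c => iSup_le fun r => iSup_le fun hr => iSup_le fun hxc => ?_
  by_cases hB : ∃ y ∈ Metric.ball c r, y ∈ annulus n j
  · obtain ⟨y, hyc, hy⟩ := hB
    rw [mem_annulus] at hx hy
    have hxy : ‖x - y‖ < 2 * r := by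
      rw [← dist_eq_norm]
      calc dist x y ≤ dist x c + dist y c := dist_triangle_right _ _ _
        _ < _ := by linarith [Metric.mem_ball.1 hxc, Metric.mem_ball.1 hyc]
    have hr' : (2 : ℝ) ^ (max j k - 3) ≤ r := by
      have e : ∀ i : ℤ, (2 : ℝ) ^ (i + 1) = 2 * 2 ^ i := fun i => by
        rw [zpow_add_one₀ two_ne_zero, mul_comm]
      have e1 := e (max j k - 3)
      have e2 := e (max j k - 2)
      rw [show max j k - 3 + 1 = max j k - 2 by ring] at e1
      rw [show max j k - 2 + 1 = max j k - 1 by ring] at e2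
      rcases le_abs.1 hjk with h | h
      · rw [max_eq_left (by linarith)] at *
        have h2 : (2 : ℝ) ^ k ≤ 2 ^ (j - 2) := zpow_le_zpow_right₀ one_le_two (by linarith)
        have h3 := norm_sub_norm_le y x
        rw [norm_sub_rev] at h3
        linarith
      · rw [max_eq_right (by linarith)] at *
        have h2 : (2 : ℝ) ^ j ≤ 2 ^ (k - 2) := zpow_le_zpow_right₀ one_le_two (by linarith)
        have h3 := norm_sub_norm_le x y
        linarith
    refine mul_le_mul' ?_ ?_
    · calc (volume (Metric.ball c r))⁻¹
          ≤ (volume (Metric.ball c ((2 : ℝ) ^ (max j k - 3))))⁻¹ :=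
            ENNReal.inv_le_inv.2 (measure_mono (Metric.ball_subset_ball hr'))
        _ = _ := by
          rw [volume_ball_zpow, ENNReal.mul_inv (Or.inl (two_rpow_ne_zero _))
            (Or.inl (two_rpow_ne_top _)), ← ENNReal.rpow_neg, mul_right_comm, mul_comm _ _⁻¹,
            mul_comm _ _⁻¹]
          congr 1
          rw [show (8 : ℝ≥0∞) = 2 ^ (3 : ℝ) by norm_num [show (3 : ℝ) = (3 : ℕ) by norm_num,
            -Nat.cast_ofNat], ← ENNReal.rpow_natCast, ← ENNReal.rpow_mul, ← two_rpow_add]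
          congr 1
          push_cast
          ring
    · rw [← lintegral_indicator (s := Metric.ball 0 _) measurableSet_ball]
      refine (setLIntegral_le_lintegral _ _).trans (lintegral_mono fun z => ?_)
      by_cases hz : z ∈ annulus n j
      · rw [indicator_of_mem (s := Metric.ball 0 (2 ^ j))
          (mem_ball_zero_iff.2 (mem_annulus.1 hz).1)]
      · simp [hz]
  · have : ∫⁻ y in Metric.ball c r, (annulus n j).indicator f y = 0 := by
      rw [← lintegral_indicator measurableSet_ball]
      refine (lintegral_congr fun y => ?_).trans lintegral_zero
      by_cases hy : y ∈ Metric.ball c r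
      · rw [indicator_of_mem hy, indicator_of_notMem fun h => hB ⟨y, hy, h⟩]
      · rw [indicator_of_notMem hy]
    rw [this, mul_zero]
    exact zero_le

lemma exists_setLIntegral_ball_le {n : ℕ} {q : Fin n → ℝ} (hq : ∀ i, 1 < q i) :
    ∃ D : ℝ≥0∞, D ≠ ∞ ∧ ∀ g : Euc n → ℝ≥0∞, Measurable g → ∀ j : ℤ,
      ∫⁻ y in Metric.ball 0 (2 ^ j), g y ≤
        D * (2 : ℝ≥0∞) ^ ((j : ℝ) * (n - ∑ i, 1 / q i)) * mixedNorm q g := by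
  have hq0 : ∀ i, 0 < q i := fun i => by linarith [hq i]
  obtain ⟨C, hC, H⟩ := exists_mixedNorm_maximalFn_le hq
  set a := ∑ i, 1 / q i with ha
  set v := volume (Metric.ball (0 : Euc n) 1) with hv
  have hvt : v ≠ ∞ := measure_ball_lt_top.ne
  set κ : ℝ≥0∞ := ENNReal.ofReal (2 / (n + 1)) ^ a with hκ
  have h1 : ENNReal.ofReal (2 / (n + 1)) ≠ 0 := by
    rw [ne_eq, ENNReal.ofReal_eq_zero, not_le]; positivity
  have hκ0 : κ ≠ 0 := (ENNReal.rpow_pos (pos_iff_ne_zero.2 h1) ENNReal.ofReal_ne_top).ne'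
  have hκt : κ ≠ ∞ := by
    obtain ⟨x, hx⟩ := exists_eq_expE h1 ENNReal.ofReal_ne_top
    rw [hκ, hx, expE_rpow]
    exact expE_ne_top _
  refine ⟨v * (C / κ), ENNReal.mul_ne_top hvt (ENNReal.div_ne_top hC hκ0), fun g hg j => ?_⟩
  have hj : (0 : ℝ) < 2 ^ j := by positivity
  have hB0 : volume (Metric.ball (0 : Euc n) (2 ^ j)) ≠ 0 := (Metric.measure_ball_pos _ _ hj).ne'
  have hBt : volume (Metric.ball (0 : Euc n) (2 ^ j)) ≠ ∞ := measure_ball_lt_top.ne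
  set c := (volume (Metric.ball (0 : Euc n) (2 ^ j)))⁻¹ * ∫⁻ y in Metric.ball 0 (2 ^ j), g y
    with hc
  have hlow : κ * (2 : ℝ≥0∞) ^ ((j : ℝ) * a) ≤
      mixedNorm q ((Metric.ball 0 (2 ^ j)).indicator 1) := by
    refine le_trans (le_of_eq ?_) (le_mixedNorm_indicator_ball hq0 hj)
    have ha0 : 0 ≤ a := Finset.sum_nonneg fun i _ => one_div_nonneg.2 (hq0 i).le
    rw [hκ, ENNReal.rpow_mul, ← ENNReal.mul_rpow_of_nonneg _ _ ha0, ← ofReal_two_zpow,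
      ← ENNReal.ofReal_mul (by positivity)]
    congr 2
    ring
  have hcle : c ≤ C * mixedNorm q g / (κ * (2 : ℝ≥0∞) ^ ((j : ℝ) * a)) := by
    refine ENNReal.le_of_forall_nnreal_lt fun d hd => ?_
    rw [ENNReal.le_div_iff_mul_le (Or.inl (mul_ne_zero hκ0 (two_rpow_ne_zero _)))
      (Or.inl (ENNReal.mul_ne_top hκt (two_rpow_ne_top _)))]
    calc _ ≤ (d : ℝ≥0∞) * mixedNorm q ((Metric.ball 0 (2 ^ j)).indicator 1) :=
          mul_le_mul_right hlow _
      _ = mixedNorm q (fun x => d * (Metric.ball 0 (2 ^ j)).indicator 1 x) :=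
          (mixedNorm_const_mul hq0 ENNReal.coe_ne_top _).symm
      _ ≤ mixedNorm q (maximalFn g) := mixedNorm_mono hq0 fun x => by
          by_cases hx : x ∈ Metric.ball (0 : Euc n) (2 ^ j)
          · rw [indicator_of_mem hx, Pi.one_apply, mul_one]
            exact hd.le.trans (average_le_maximalFn g hj hx)
          · simp [hx]
      _ ≤ _ := H g hg
  calc _ = volume (Metric.ball (0 : Euc n) (2 ^ j)) * c := by
        rw [hc, ← mul_assoc, ENNReal.mul_inv_cancel hB0 hBt, one_mul]
    _ ≤ _ := mul_le_mul_right hcle _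
    _ = _ := by
      rw [volume_ball_zpow, ← hv, mul_sub, sub_eq_add_neg, two_rpow_add, div_eq_mul_inv,
        div_eq_mul_inv, ENNReal.mul_inv (Or.inl hκ0) (Or.inl hκt), ENNReal.rpow_neg]
      ring

/-! ### Summation over the annuli -/

lemma tsum_int_two_rpow_sub (d : ℝ) (k : ℤ) :
    ∑' j : ℤ, (2 : ℝ≥0∞) ^ (-(d * |(k : ℝ) - j|)) = ∑' m : ℤ, (2 : ℝ≥0∞) ^ (-(d * |(m : ℝ)|)) := by
  rw [← (Equiv.subLeft k).tsum_eq fun m : ℤ => (2 : ℝ≥0∞) ^ (-(d * |(m : ℝ)|))]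
  simp

lemma exists_tsum_conv_rpow_le {δ p : ℝ} (hδ : 0 < δ) (hp : 0 < p) :
    ∃ C : ℝ≥0∞, C ≠ ∞ ∧ ∀ S : ℤ → ℝ≥0∞,
      ∑' k : ℤ, (∑' j : ℤ, (2 : ℝ≥0∞) ^ (-(δ * |(k : ℝ) - j|)) * S j) ^ p ≤
        C * ∑' j, S j ^ p := by
  refine ⟨(∑' m : ℤ, (2 : ℝ≥0∞) ^ (-(δ / 2 * |(m : ℝ)|))) ^ p *
      ∑' m : ℤ, (2 : ℝ≥0∞) ^ (-(δ / 2 * p * |(m : ℝ)|)),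
    ENNReal.mul_ne_top (ENNReal.rpow_ne_top_of_nonneg hp.le
      (tsum_int_two_rpow_ne_top (by positivity))) (tsum_int_two_rpow_ne_top (by positivity)),
    fun S => ?_⟩
  calc _ ≤ ∑' k : ℤ, (∑' m : ℤ, (2 : ℝ≥0∞) ^ (-(δ / 2 * |(m : ℝ)|))) ^ p *
        ∑' j : ℤ, (2 : ℝ≥0∞) ^ (-(δ / 2 * p * |(j : ℝ) - k|)) * S j ^ p := by
        refine ENNReal.tsum_le_tsum fun k => ?_
        rw [← tsum_int_two_rpow_sub _ k]
        have h1 : ∀ j : ℤ, (2 : ℝ≥0∞) ^ (-(δ * |(k : ℝ) - j|)) * S j =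
            (2 : ℝ≥0∞) ^ (-(δ / 2 * |(k : ℝ) - j|)) *
              ((2 : ℝ≥0∞) ^ (-(δ / 2 * |(k : ℝ) - j|)) * S j) := fun j => by
          rw [← mul_assoc, ← two_rpow_add]
          congr 2
          ring
        simp_rw [h1]
        refine (tsum_mul_rpow_le hp _ _).trans_eq ?_
        congr 1
        refine tsum_congr fun j => ?_
        rw [ENNReal.mul_rpow_of_nonneg _ _ hp.le, ← ENNReal.rpow_mul, abs_sub_comm]
        congr 2
        ring
    _ = _ := by
        rw [ENNReal.tsum_mul_left, mul_assoc]
        congr 1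
        rw [ENNReal.tsum_comm, ← ENNReal.tsum_mul_left]
        refine tsum_congr fun j => ?_
        rw [ENNReal.tsum_mul_right, tsum_int_two_rpow_sub]

section Herz

variable {n : ℕ} {q : Fin n → ℝ}

lemma two_rpow_mul_maximalFn_annulus_le {D : ℝ≥0∞} {α δ : ℝ}
    (hD : ∀ g : Euc n → ℝ≥0∞, Measurable g → ∀ j : ℤ, ∫⁻ y in Metric.ball 0 (2 ^ j), g y ≤
        D * (2 : ℝ≥0∞) ^ ((j : ℝ) * (n - ∑ i, 1 / q i)) * mixedNorm q g)
    (h₁ : δ ≤ α + ∑ i, 1 / q i) (h₂ : δ ≤ n - ∑ i, 1 / q i - α)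
    {f : Euc n → ℝ≥0∞} (hf : Measurable f) {j k : ℤ} (hjk : 2 ≤ |j - k|) {x : Euc n}
    (hx : x ∈ annulus n k) :
    (2 : ℝ≥0∞) ^ ((k : ℝ) * (α + ∑ i, 1 / q i)) * maximalFn ((annulus n j).indicator f) x ≤
      8 ^ n * (volume (Metric.ball (0 : Euc n) 1))⁻¹ * D *
        ((2 : ℝ≥0∞) ^ (-(δ * |(k : ℝ) - j|)) *
          ((2 : ℝ≥0∞) ^ ((j : ℝ) * α) * mixedNorm q ((annulus n j).indicator f))) := by
  set a := ∑ i, 1 / q i with ha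
  set T := mixedNorm q ((annulus n j).indicator f) with hT
  set E : ℝ≥0∞ := 8 ^ n * (volume (Metric.ball (0 : Euc n) 1))⁻¹ with hE
  have h0 := (maximalFn_annulus_le (f := f) hjk hx).trans (mul_le_mul_right
    (hD _ (hf.indicator (measurableSet_annulus n j)) j) _)
  calc _ ≤ _ := mul_le_mul_right h0 _
    _ = E * D * ((2 : ℝ≥0∞) ^ ((k : ℝ) * (α + a) + -(max (j : ℝ) k * n) + (j : ℝ) * (n - a)) *
          T) := by
        rw [two_rpow_add, two_rpow_add]
        ring
    _ ≤ _ := by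
        refine mul_le_mul_right ?_ _
        rw [← mul_assoc, ← two_rpow_add]
        refine mul_le_mul_left (two_rpow_le ?_) _
        rcases le_total (j : ℝ) k with h | h
        · rw [max_eq_right h, abs_of_nonneg (by linarith)]
          nlinarith [mul_le_mul_of_nonneg_right h₂ (sub_nonneg.2 h)]
        · rw [max_eq_left h, abs_of_nonpos (by linarith)]
          nlinarith [mul_le_mul_of_nonneg_right h₁ (sub_nonneg.2 h)]

lemma exists_mixedNorm_annulus_maximalFn_le (hn : 2 ≤ n) (hq : ∀ i, 1 < q i) {α δ : ℝ}
    (hδ : 0 ≤ δ) (h₁ : δ ≤ α + ∑ i, 1 / q i) (h₂ : δ ≤ n - ∑ i, 1 / q i - α) :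
    ∃ A : ℝ≥0∞, A ≠ ∞ ∧ ∀ f : Euc n → ℝ≥0∞, Measurable f → ∀ k : ℤ,
      (2 : ℝ≥0∞) ^ ((k : ℝ) * α) * mixedNorm q ((annulus n k).indicator (maximalFn f)) ≤
        A * ∑' j : ℤ, (2 : ℝ≥0∞) ^ (-(δ * |(k : ℝ) - j|)) *
          ((2 : ℝ≥0∞) ^ ((j : ℝ) * α) * mixedNorm q ((annulus n j).indicator f)) := by
  have hq0 : ∀ i, 0 < q i := fun i => by linarith [hq i]
  have hq1 : ∀ i, 1 ≤ q i := fun i => (hq i).le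
  obtain ⟨C, hC, HC⟩ := exists_mixedNorm_maximalFn_le hq
  obtain ⟨D, hD, HD⟩ := exists_setLIntegral_ball_le hq
  set a := ∑ i, 1 / q i with ha
  have ha0 : 0 ≤ a := Finset.sum_nonneg fun i _ => one_div_nonneg.2 (hq0 i).le
  set E : ℝ≥0∞ := 8 ^ n * (volume (Metric.ball (0 : Euc n) 1))⁻¹ * D with hE
  have hEt : E ≠ ∞ := ENNReal.mul_ne_top (ENNReal.mul_ne_top (by finiteness)
    (ENNReal.inv_ne_top.2 (Metric.measure_ball_pos _ _ one_pos).ne')) hD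
  refine ⟨C * 2 ^ (|α| + δ) + E * 2 ^ a + 1, by
    simp [hC, hEt, ENNReal.mul_eq_top], fun f hf k => ?_⟩
  set T : ℤ → ℝ≥0∞ := fun j => mixedNorm q ((annulus n j).indicator f) with hT
  set S : ℤ → ℝ≥0∞ := fun j =>
    (2 : ℝ≥0∞) ^ (-(δ * |(k : ℝ) - j|)) * ((2 : ℝ≥0∞) ^ ((j : ℝ) * α) * T j) with hS
  set W := ∑' j, S j with hW
  change _ ≤ _ * W
  rcases eq_or_ne W ∞ with hWt | hWt
  · rw [hWt, ENNReal.mul_top (by simp)]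
    exact le_top
  set s : Finset ℤ := Finset.Icc (k - 1) (k + 1) with hs
  set M : ℤ → Euc n → ℝ≥0∞ := fun j => maximalFn ((annulus n j).indicator f) with hM
  set c : ℝ≥0∞ := (2 : ℝ≥0∞) ^ (-((k : ℝ) * (α + a))) * (E * W) with hc
  have hct : c ≠ ∞ := ENNReal.mul_ne_top (two_rpow_ne_top _) (ENNReal.mul_ne_top hEt hWt)
  have hpt : ∀ x, (annulus n k).indicator (maximalFn f) x ≤
      ∑ j ∈ s, M j x + c * (Metric.ball 0 (2 ^ k)).indicator 1 x := by
    intro x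
    by_cases hx : x ∈ annulus n k
    · rw [indicator_of_mem hx, indicator_of_mem (mem_ball_zero_iff.2 (mem_annulus.1 hx).1),
        Pi.one_apply, mul_one]
      calc maximalFn f x ≤ ∑' j, M j x := maximalFn_le_tsum_annulus hn hf x
        _ ≤ ∑' j, ((if j ∈ s then M j x else 0) +
              (2 : ℝ≥0∞) ^ (-((k : ℝ) * (α + a))) * (E * S j)) := by
            refine ENNReal.tsum_le_tsum fun j => ?_
            by_cases hj : j ∈ s
            · simp [hj]
            · have hjk : 2 ≤ |j - k| := by
                rw [hs, Finset.mem_Icc] at hj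
                by_contra! h
                have := abs_lt.1 h
                omega
              rw [if_neg hj, zero_add]
              calc M j x = (2 : ℝ≥0∞) ^ (-((k : ℝ) * (α + a))) *
                    ((2 : ℝ≥0∞) ^ ((k : ℝ) * (α + a)) * M j x) := by
                    rw [← mul_assoc, ← two_rpow_add]
                    simp
                _ ≤ _ := mul_le_mul_right
                    (two_rpow_mul_maximalFn_annulus_le HD h₁ h₂ hf hjk hx) _
        _ = _ := by
            rw [ENNReal.tsum_add, ENNReal.tsum_mul_left, ENNReal.tsum_mul_left,
              tsum_eq_sum (s := s) (fun j hj => if_neg hj)]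
            congr 1
            exact Finset.sum_congr rfl fun j hj => if_pos hj
    · simp [hx]
  have hMm : ∀ j, Measurable (M j) := fun j => measurable_maximalFn _
  have hnear : ∀ j ∈ s, (2 : ℝ≥0∞) ^ ((k : ℝ) * α) * T j ≤ 2 ^ (|α| + δ) * S j := by
    intro j hj
    rw [hs, Finset.mem_Icc] at hj
    have h3 : |(k : ℝ) - j| ≤ 1 := by
      rw [abs_le]
      have h4 : ((k - 1 : ℤ) : ℝ) ≤ j := Int.cast_le.2 hj.1
      have h5 : (j : ℝ) ≤ ((k + 1 : ℤ) : ℝ) := Int.cast_le.2 hj.2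
      push_cast at h4 h5
      constructor <;> linarith
    simp only [hS]
    rw [← mul_assoc, ← mul_assoc, ← two_rpow_add, ← two_rpow_add]
    refine mul_le_mul_left (two_rpow_le ?_) _
    have h4 : ((k : ℝ) - j) * α ≤ |α| := by
      calc _ ≤ |((k : ℝ) - j) * α| := le_abs_self _
        _ = |(k : ℝ) - j| * |α| := abs_mul _ _
        _ ≤ _ := mul_le_of_le_one_left (abs_nonneg _) h3
    nlinarith [mul_le_mul_of_nonneg_left h3 hδ]
  calc _ ≤ (2 : ℝ≥0∞) ^ ((k : ℝ) * α) * mixedNorm q (fun x =>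
        ∑ j ∈ s, M j x + c * (Metric.ball 0 (2 ^ k)).indicator 1 x) :=
        mul_le_mul_right (mixedNorm_mono hq0 hpt) _
    _ ≤ (2 : ℝ≥0∞) ^ ((k : ℝ) * α) * (∑ j ∈ s, C * T j +
          c * (2 ^ a * (2 : ℝ≥0∞) ^ ((k : ℝ) * a))) := by
        refine mul_le_mul_right ?_ _
        refine (mixedNorm_add_le hq1 (Finset.measurable_sum s fun j _ => hMm j)
          ((measurable_one.indicator measurableSet_ball).const_mul _)).trans (add_le_add ?_ ?_)
        · exact (mixedNorm_finset_sum_le hq1 s hMm).trans (Finset.sum_le_sum fun j _ =>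
            HC _ (hf.indicator (measurableSet_annulus n j)))
        · rw [mixedNorm_const_mul hq0 hct]
          refine mul_le_mul_right ((mixedNorm_indicator_ball_le hq0 (by positivity)).trans_eq ?_) _
          rw [ENNReal.ofReal_mul two_pos.le, ofReal_two_zpow, ENNReal.mul_rpow_of_nonneg _ _ ha0,
            ← ENNReal.rpow_mul]
          norm_num
    _ = C * ∑ j ∈ s, (2 : ℝ≥0∞) ^ ((k : ℝ) * α) * T j + E * 2 ^ a * W := by
        rw [mul_add, ← Finset.mul_sum, mul_left_comm, Finset.mul_sum]
        congr 1
        calc _ = E * 2 ^ a * W * (2 : ℝ≥0∞) ^ ((k : ℝ) * α + -((k : ℝ) * (α + a)) +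
              (k : ℝ) * a) := by
              rw [two_rpow_add, two_rpow_add]
              ring
          _ = _ := by
              rw [show (k : ℝ) * α + -((k : ℝ) * (α + a)) + (k : ℝ) * a = 0 by ring,
                ENNReal.rpow_zero, mul_one]
    _ ≤ C * (2 ^ (|α| + δ) * W) + E * 2 ^ a * W := by
        refine add_le_add_left (mul_le_mul_right ?_ _) _
        calc _ ≤ ∑ j ∈ s, 2 ^ (|α| + δ) * S j := Finset.sum_le_sum hnear
          _ = 2 ^ (|α| + δ) * ∑ j ∈ s, S j := by rw [Finset.mul_sum]
          _ ≤ _ := mul_le_mul_right (ENNReal.sum_le_tsum s) _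
    _ = (C * 2 ^ (|α| + δ) + E * 2 ^ a) * W := by ring
    _ ≤ _ := mul_le_mul_left le_self_add _

lemma herzNorm_rpow {N : (Euc n → ℝ≥0∞) → ℝ≥0∞} {α p : ℝ} (hp : 0 < p) (f : Euc n → ℝ≥0∞) :
    herzNorm N α p f ^ p =
      ∑' k : ℤ, ((2 : ℝ≥0∞) ^ ((k : ℝ) * α) * N ((annulus n k).indicator f)) ^ p := by
  rw [herzNorm, ← ENNReal.rpow_mul, one_div_mul_cancel hp.ne', ENNReal.rpow_one]
  refine tsum_congr fun k => ?_
  rw [ENNReal.mul_rpow_of_nonneg _ _ hp.le, ← ENNReal.rpow_mul]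
  congr 2
  ring

lemma two_rpow_mul_le_herzNorm {N : (Euc n → ℝ≥0∞) → ℝ≥0∞} {α p : ℝ} (hp : 0 < p)
    (f : Euc n → ℝ≥0∞) (k : ℤ) :
    (2 : ℝ≥0∞) ^ ((k : ℝ) * α) * N ((annulus n k).indicator f) ≤ herzNorm N α p f := by
  rw [← ENNReal.rpow_le_rpow_iff hp, herzNorm_rpow hp]
  exact ENNReal.le_tsum (f := fun k : ℤ =>
    ((2 : ℝ≥0∞) ^ ((k : ℝ) * α) * N ((annulus n k).indicator f)) ^ p) k

lemma exists_herzNorm_maximalFn_le (hn : 2 ≤ n) (hq : ∀ i, 1 < q i) {α p : ℝ} (hp : 0 < p)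
    (h₁ : 0 < α + ∑ i, 1 / q i) (h₂ : 0 < n - ∑ i, 1 / q i - α) :
    ∃ C : ℝ≥0∞, C ≠ ∞ ∧ ∀ f : Euc n → ℝ≥0∞, Measurable f →
      herzNorm (mixedNorm q) α p (maximalFn f) ≤ C * herzNorm (mixedNorm q) α p f := by
  have hδ := lt_min h₁ h₂
  obtain ⟨A, hA, HA⟩ := exists_mixedNorm_annulus_maximalFn_le hn hq hδ.le (min_le_left _ _)
    (min_le_right _ _)
  obtain ⟨B, hB, HB⟩ := exists_tsum_conv_rpow_le hδ hp
  refine ⟨A * B ^ (1 / p), ENNReal.mul_ne_top hA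
    (ENNReal.rpow_ne_top_of_nonneg (by positivity) hB), fun f hf => ?_⟩
  rw [← ENNReal.rpow_le_rpow_iff hp, ENNReal.mul_rpow_of_nonneg _ _ hp.le,
    ENNReal.mul_rpow_of_nonneg _ _ hp.le, ← ENNReal.rpow_mul, one_div_mul_cancel hp.ne',
    ENNReal.rpow_one, herzNorm_rpow hp, herzNorm_rpow hp, mul_assoc]
  refine (ENNReal.tsum_le_tsum fun k => ENNReal.rpow_le_rpow (HA f hf k) hp.le).trans ?_
  simp_rw [ENNReal.mul_rpow_of_nonneg A _ hp.le]
  rw [ENNReal.tsum_mul_left]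
  exact mul_le_mul_right (HB _) _

lemma setLIntegral_ball_lt_top_of_herzNorm (hn : 2 ≤ n) (hq : ∀ i, 1 < q i) {α p : ℝ}
    (hp : 0 < p) (h₂ : 0 < n - ∑ i, 1 / q i - α) {f : Euc n → ℝ≥0∞} (hf : Measurable f)
    (hfin : herzNorm (mixedNorm q) α p f ≠ ∞) (x : Euc n) (r : ℝ) :
    ∫⁻ y in Metric.ball x r, f y < ∞ := by
  obtain ⟨D, hD, HD⟩ := exists_setLIntegral_ball_le hq
  set d := n - ∑ i, 1 / q i - α with hd
  set H := herzNorm (mixedNorm q) α p f with hH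
  obtain ⟨J, hJ⟩ := pow_unbounded_of_one_lt (‖x‖ + r) (one_lt_two (α := ℝ))
  have hsub : Metric.ball x r ⊆ Metric.ball 0 (2 ^ (J : ℤ)) := fun y hy => by
    rw [mem_ball_zero_iff, zpow_natCast]
    have h3 := norm_sub_norm_le y x
    linarith [mem_ball_iff_norm.1 hy]
  have hterm : ∀ j : ℤ, ∫⁻ y in Metric.ball 0 (2 ^ (J : ℤ)), (annulus n j).indicator f y ≤
      D * H * (2 : ℝ≥0∞) ^ ((J : ℝ) * d) * (2 : ℝ≥0∞) ^ (-(d * |((J : ℤ) : ℝ) - j|)) := by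
    intro j
    rcases le_or_gt j J with hj | hj
    · calc _ ≤ ∫⁻ y in Metric.ball 0 (2 ^ j), (annulus n j).indicator f y := by
            rw [← lintegral_indicator (s := Metric.ball 0 (2 ^ j)) measurableSet_ball]
            refine (setLIntegral_le_lintegral _ _).trans (lintegral_mono fun z => ?_)
            by_cases hz : z ∈ annulus n j
            · rw [indicator_of_mem (s := Metric.ball 0 (2 ^ j))
                (mem_ball_zero_iff.2 (mem_annulus.1 hz).1)]
            · simp [hz]
        _ ≤ _ := HD _ (hf.indicator (measurableSet_annulus n j)) j
        _ = D * (2 : ℝ≥0∞) ^ ((j : ℝ) * d) * ((2 : ℝ≥0∞) ^ ((j : ℝ) * α) *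
              mixedNorm q ((annulus n j).indicator f)) := by
            rw [show (j : ℝ) * (n - ∑ i, 1 / q i) = (j : ℝ) * d + (j : ℝ) * α by rw [hd]; ring,
              two_rpow_add]
            ring
        _ ≤ D * (2 : ℝ≥0∞) ^ ((j : ℝ) * d) * H :=
            mul_le_mul_right (two_rpow_mul_le_herzNorm hp f j) _
        _ = _ := by
            rw [mul_assoc (D * H), ← two_rpow_add, mul_right_comm]
            congr 2
            have : (j : ℝ) ≤ ((J : ℤ) : ℝ) := Int.cast_le.2 hj
            rw [abs_of_nonneg (by linarith), Int.cast_natCast]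
            ring
    · refine le_trans (le_of_eq ?_) zero_le
      rw [← lintegral_indicator measurableSet_ball]
      refine (lintegral_congr fun y => ?_).trans lintegral_zero
      by_cases hy : y ∈ Metric.ball (0 : Euc n) (2 ^ (J : ℤ))
      · rw [indicator_of_mem hy, indicator_of_notMem fun h => ?_]
        have h3 : (2 : ℝ) ^ (J : ℤ) ≤ 2 ^ (j - 1) :=
          zpow_le_zpow_right₀ one_le_two (by omega)
        linarith [mem_ball_zero_iff.1 hy, (mem_annulus.1 h).2]
      · rw [indicator_of_notMem hy]
  calc _ ≤ ∫⁻ y in Metric.ball 0 (2 ^ (J : ℤ)), f y := lintegral_mono_set hsub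
    _ ≤ _ := setLIntegral_le_tsum_annulus hn hf _
    _ ≤ _ := ENNReal.tsum_le_tsum hterm
    _ < ∞ := by
      rw [ENNReal.tsum_mul_left, tsum_int_two_rpow_sub, lt_top_iff_ne_top]
      exact ENNReal.mul_ne_top (ENNReal.mul_ne_top (ENNReal.mul_ne_top hD hfin)
        (two_rpow_ne_top _)) (tsum_int_two_rpow_ne_top h₂)

end Herz

/-- Let `n ≥ 2`, `0 < p < ∞` and `q⃗ = (q_1,…,q_n)` with `1 < q_i < ∞`.
If `−Σ 1/q_i < α < Σ 1/q_i'`, then the Hardy–Littlewood maximal operator is bounded on the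
mixed Herz space `K̇^{α,p}_{q⃗}(ℝⁿ)`. -/
theorem stmt15 {n : ℕ} (hn : 2 ≤ n) (α p : ℝ) (hp : 0 < p) (q : Fin n → ℝ)
    (hq : ∀ i, 1 < q i)
    (hα : -(∑ i, 1 / q i) < α ∧ α < ∑ i, (1 - 1 / q i)) :
    ∃ C : ℝ≥0∞, 0 < C ∧ C < ∞ ∧
      ∀ f : Euc n → ℝ≥0∞, Measurable f → herzNorm (mixedNorm q) α p f ≠ ∞ →
        (∀ (x : Euc n) (r : ℝ), 0 < r → ∫⁻ y in Metric.ball x r, f y ∂volume < ∞) ∧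
        herzNorm (mixedNorm q) α p (maximalFn f) ≤ C * herzNorm (mixedNorm q) α p f := by
  have h₁ : 0 < α + ∑ i, 1 / q i := by linarith [hα.1]
  have h₂ : 0 < n - ∑ i, 1 / q i - α := by
    have h := hα.2
    rw [Finset.sum_sub_distrib, Finset.sum_const, Finset.card_univ, Fintype.card_fin,
      nsmul_eq_mul, mul_one] at h
    linarith
  obtain ⟨C, hC, H⟩ := exists_herzNorm_maximalFn_le hn hq hp h₁ h₂
  refine ⟨C + 1, by simp, ENNReal.add_lt_top.2 ⟨hC.lt_top, ENNReal.one_lt_top⟩,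
    fun f hf hfin => ⟨fun x r _ => setLIntegral_ball_lt_top_of_herzNorm hn hq hp h₂ hf hfin x r,
      (H f hf).trans (mul_le_mul_left le_self_add _)⟩⟩
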